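/- arXiv:2511.02001 — 2 statements merged into one kernel-verified Lean document; each statement's English description precedes it below -/
import Mathlib

section
/- Let Φ and Ψ be hyperbolic linear flows on X = ℝ^d and 0 < β < 1. If β² ≤ ρ(Φ,Ψ), then Φ ≃^{β⁻} Ψ, i.e. there exist h ∈ 𝓗_{β⁻}(X) and α ∈ ℝ∖{0} with h(Φ_t x) = Ψ_{αt} h(x) for all t ∈ ℝ and x ∈ X. -/
noncomputable section
namespace LF

open Filter Topology

/-- `ℝ^d` with the Euclidean norm. -/
abbrev Euc (d : ℕ) := EuclideanSpace ℝ (Fin d)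

variable {d : ℕ}

/-- The time-`t` map of the linear flow on `ℝ^d` generated by the matrix `A`,
i.e. `x ↦ exp (t A) x`. -/
def linFlow (A : Matrix (Fin d) (Fin d) ℝ) (t : ℝ) (x : Euc d) : Euc d :=
  Matrix.toEuclideanLin (NormedSpace.exp (t • A)) x

/-- The orbit `{Φ_t x : t ∈ ℝ}` of `x` under the linear flow generated by `A`. -/
def flowOrbit (A : Matrix (Fin d) (Fin d) ℝ) (x : Euc d) : Set (Euc d) :=
  Set.range fun t : ℝ => linFlow A t x

/-- `Φ` is `h`-related to `Ψ`: the homeomorphism `h` maps every orbit of the flow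
generated by `A` onto an orbit of the flow generated by `B`. -/
def IsOrbitEquiv (A B : Matrix (Fin d) (Fin d) ℝ) (h : Euc d ≃ₜ Euc d) : Prop :=
  ∀ x : Euc d, h '' flowOrbit A x = flowOrbit B (h x)

/-- `f` satisfies a `β`-Hölder condition on some ball centred at `0`. -/
def HolderNearZero (β : ℝ) (f : Euc d → Euc d) : Prop :=
  ∃ r > (0 : ℝ), ∃ K : ℝ, ∀ x ∈ Metric.ball (0 : Euc d) r, ∀ y ∈ Metric.ball (0 : Euc d) r,
    dist (f x) (f y) ≤ K * dist x y ^ β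

/-- `h ∈ 𝓗_β`: `h 0 = 0` and `h`, `h⁻¹` both satisfy a `β`-Hölder condition near `0`. -/
def MemHolderClass (β : ℝ) (h : Euc d ≃ₜ Euc d) : Prop :=
  h 0 = 0 ∧ HolderNearZero β ⇑h ∧ HolderNearZero β ⇑h.symm

/-- `h ∈ 𝓗_0`: homeomorphisms fixing `0`. -/
def MemH0 (h : Euc d ≃ₜ Euc d) : Prop := h 0 = 0

/-- `h ∈ 𝓗_{0⁺} = ⋃_{γ>0} 𝓗_γ`. -/
def MemH0plus (h : Euc d ≃ₜ Euc d) : Prop := ∃ γ : ℝ, 0 < γ ∧ MemHolderClass γ h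

/-- `h ∈ 𝓗_{1⁻} = ⋂_{0<γ<1} 𝓗_γ`. -/
def MemH1minus (h : Euc d ≃ₜ Euc d) : Prop := ∀ γ : ℝ, 0 < γ → γ < 1 → MemHolderClass γ h

/-- `h ∈ 𝓗_{β⁻} = ⋂_{0<γ<β} 𝓗_γ`. -/
def MemHBelow (β : ℝ) (h : Euc d ≃ₜ Euc d) : Prop :=
  ∀ γ : ℝ, 0 < γ → γ < β → MemHolderClass γ h

/-- `h ∈ 𝓗_{β⁺} = ⋃_{γ>β} 𝓗_γ`. -/
def MemHAbove (β : ℝ) (h : Euc d ≃ₜ Euc d) : Prop :=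
  ∃ γ : ℝ, β < γ ∧ MemHolderClass γ h

/-- `φ ~^⋆ ψ`: `φ` is `h`-related to `ψ` for some `h` in the class `P`. -/
def RelEquivWith (P : (Euc d ≃ₜ Euc d) → Prop) (A B : Matrix (Fin d) (Fin d) ℝ) : Prop :=
  ∃ h : Euc d ≃ₜ Euc d, P h ∧ IsOrbitEquiv A B h

/-- `φ ≃^⋆ ψ`: there are `h` in the class `P` and `α ≠ 0` with
`h (φ t x) = ψ (α t) (h x)` for all `t`, `x`. -/
def SimEquivWith (P : (Euc d ≃ₜ Euc d) → Prop) (A B : Matrix (Fin d) (Fin d) ℝ) : Prop :=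
  ∃ (h : Euc d ≃ₜ Euc d) (α : ℝ), α ≠ 0 ∧ P h ∧
    ∀ (t : ℝ) (x : Euc d), h (linFlow A t x) = linFlow B (α * t) (h x)

/-- The stable set `X_S^Φ = {x : Φ_t x → 0 as t → ∞}`. -/
def stableSet (A : Matrix (Fin d) (Fin d) ℝ) : Set (Euc d) :=
  {x | Tendsto (fun t : ℝ => linFlow A t x) atTop (𝓝 0)}

/-- The unstable set `X_U^Φ = {x : Φ_t x → 0 as t → -∞}`. -/
def unstableSet (A : Matrix (Fin d) (Fin d) ℝ) : Set (Euc d) :=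
  {x | Tendsto (fun t : ℝ => linFlow A t x) atBot (𝓝 0)}

/-- The central set `X_C^Φ = {x : e^{-ε|t|} Φ_t x → 0 as |t| → ∞, for every ε > 0}`. -/
def centralSet (A : Matrix (Fin d) (Fin d) ℝ) : Set (Euc d) :=
  {x | ∀ ε > (0 : ℝ),
    Tendsto (fun t : ℝ => Real.exp (-(ε * |t|)) • linFlow A t x) (atBot ⊔ atTop) (𝓝 0)}

/-- The stable subspace of the flow generated by `A` (the stable set is a subspace,
so taking its span is innocuous). -/
def XS (A : Matrix (Fin d) (Fin d) ℝ) : Submodule ℝ (Euc d) := Submodule.span ℝ (stableSet A)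

/-- The unstable subspace. -/
def XU (A : Matrix (Fin d) (Fin d) ℝ) : Submodule ℝ (Euc d) := Submodule.span ℝ (unstableSet A)

/-- The central subspace. -/
def XC (A : Matrix (Fin d) (Fin d) ℝ) : Submodule ℝ (Euc d) := Submodule.span ℝ (centralSet A)

/-- The hyperbolic subspace `X_H^Φ = X_S^Φ ⊕ X_U^Φ`. -/
def XH (A : Matrix (Fin d) (Fin d) ℝ) : Submodule ℝ (Euc d) := XS A ⊔ XU A

def dimS (A : Matrix (Fin d) (Fin d) ℝ) : ℕ := Module.finrank ℝ (XS A)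
def dimU (A : Matrix (Fin d) (Fin d) ℝ) : ℕ := Module.finrank ℝ (XU A)
def dimHyp (A : Matrix (Fin d) (Fin d) ℝ) : ℕ := Module.finrank ℝ (XH A)

/-- The central-part generators `A^{Φ_C}` and `α A^{Ψ_C}` are similar, i.e.
`Q A_C = (α B_C) Q` for some linear isomorphism `Q : X_C^Φ → X_C^Ψ`. -/
def IsCentralSimilar (A B : Matrix (Fin d) (Fin d) ℝ) (α : ℝ) : Prop :=
  ∃ (hA : ∀ x ∈ XC A, Matrix.toEuclideanLin A x ∈ XC A)
    (hB : ∀ x ∈ XC B, Matrix.toEuclideanLin B x ∈ XC B)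
    (Q : XC A ≃ₗ[ℝ] XC B),
    ∀ x : XC A, Q ((Matrix.toEuclideanLin A).restrict hA x)
      = α • (Matrix.toEuclideanLin B).restrict hB (Q x)

/-- The forward Lyapunov exponent `λ_+^Φ(x) = lim_{t→∞} log ‖Φ_t x‖ / t`
(the limit exists for `x ≠ 0`, so it equals the `limsup` used here). -/
def lyap (A : Matrix (Fin d) (Fin d) ℝ) (x : Euc d) : ℝ :=
  Filter.limsup (fun t : ℝ => Real.log ‖linFlow A t x‖ / t) atTop

/-- The Lyapunov space `L^Φ(s) = {x : λ_+^Φ(x) ≤ s}` (with `λ_+^Φ(0) = -∞`), as a set. -/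
def lyapSet (A : Matrix (Fin d) (Fin d) ℝ) (s : ℝ) : Set (Euc d) :=
  {x | x = 0 ∨ lyap A x ≤ s}

/-- `ℓ^Φ(s) = dim L^Φ(s)` (the Lyapunov set is a subspace, so taking its span is innocuous). -/
def ell (A : Matrix (Fin d) (Fin d) ℝ) (s : ℝ) : ℕ :=
  Module.finrank ℝ (Submodule.span ℝ (lyapSet A s))

/-- The `(j+1)`-st smallest Lyapunov exponent `λ_{j+1}^Φ`, counted with multiplicity. -/
def lyapExp (A : Matrix (Fin d) (Fin d) ℝ) (j : ℕ) : ℝ :=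
  sInf {s : ℝ | j + 1 ≤ ell A s}

/-- The Lyapunov space at `s` of the restriction of the flow to the invariant set `V`. -/
def lyapSetIn (A : Matrix (Fin d) (Fin d) ℝ) (V : Set (Euc d)) (s : ℝ) : Set (Euc d) :=
  {x | x ∈ V ∧ (x = 0 ∨ lyap A x ≤ s)}

def ellIn (A : Matrix (Fin d) (Fin d) ℝ) (V : Set (Euc d)) (s : ℝ) : ℕ :=
  Module.finrank ℝ (Submodule.span ℝ (lyapSetIn A V s))

/-- The `(j+1)`-st smallest Lyapunov exponent of the flow restricted to `V`. -/
def lyapExpIn (A : Matrix (Fin d) (Fin d) ℝ) (V : Set (Euc d)) (j : ℕ) : ℝ :=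
  sInf {s : ℝ | j + 1 ≤ ellIn A V s}

/-- `λ_{j+1}^{Φ_H}`: the `(j+1)`-st smallest Lyapunov exponent of the restriction
of the flow to the hyperbolic subspace. -/
def lyapExpH (A : Matrix (Fin d) (Fin d) ℝ) (j : ℕ) : ℝ :=
  lyapExpIn A (XH A) j

/-- The flow generated by `A` is stable: every orbit tends to `0` as `t → ∞`. -/
def IsStable (A : Matrix (Fin d) (Fin d) ℝ) : Prop := ∀ x : Euc d, x ∈ stableSet A

/-- The flow generated by `A` is unstable: every orbit tends to `0` as `t → -∞`. -/
def IsUnstable (A : Matrix (Fin d) (Fin d) ℝ) : Prop := ∀ x : Euc d, x ∈ unstableSet A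

/-- The flow generated by `A` is hyperbolic: `X = X_S ⊕ X_U`. -/
def IsHyperbolic (A : Matrix (Fin d) (Fin d) ℝ) : Prop := IsCompl (XS A) (XU A)

/-- `ρ_+(Φ,Ψ) = (min_j λ_j^Φ/λ_j^Ψ) / |max_j λ_j^Φ/λ_j^Ψ|`. -/
def rhoPlus (A B : Matrix (Fin d) (Fin d) ℝ) : ℝ :=
  (⨅ j : Fin d, lyapExp A j / lyapExp B j) / |⨆ j : Fin d, lyapExp A j / lyapExp B j|

/-- The Lyapunov cross ratio `ρ(Φ,Ψ) = max {ρ_+(Φ,Ψ), ρ_+(Φ*,Ψ)}`, where `Φ*` is the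
time-reversal of `Φ`, generated by `-A`. -/
def rho (A B : Matrix (Fin d) (Fin d) ℝ) : ℝ := max (rhoPlus A B) (rhoPlus (-A) B)

/-- The minimal period `T_x^Φ = inf {t > 0 : Φ_t x = x} ∈ [0,∞]` (with `inf ∅ = ∞`). -/
def minPeriod (A : Matrix (Fin d) (Fin d) ℝ) (x : Euc d) : EReal :=
  sInf {T : EReal | ∃ t : ℝ, 0 < t ∧ linFlow A t x = x ∧ T = (t : EReal)}

/-- The set of complex eigenvalues of the real matrix `A`. -/
def cSpec {n : ℕ} (A : Matrix (Fin n) (Fin n) ℝ) : Set ℂ :=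
  spectrum ℂ (A.map Complex.ofReal)

/-- `x` is a fixed point of the flow generated by `A`. -/
def IsFixedPt (A : Matrix (Fin d) (Fin d) ℝ) (x : Euc d) : Prop :=
  ∀ t : ℝ, linFlow A t x = x

/-- The nilpotent `m × m` Jordan block `J_m` (ones on the superdiagonal). -/
def jordanNil (m : ℕ) : Matrix (Fin m) (Fin m) ℝ :=
  Matrix.of fun i j => if (i : ℕ) + 1 = (j : ℕ) then 1 else 0

/-- `f` fixes `0` and is `γ`-Hölder near `0` for every `0 < γ < β`. -/
def Hol {E F : Type*} [NormedAddCommGroup E] [NormedAddCommGroup F] (β : ℝ) (f : E → F) : Prop :=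
  ∀ γ : ℝ, 0 < γ → γ < β → ∃ r > (0 : ℝ), ∃ K ≥ (0 : ℝ), ∀ x y : E, ‖x‖ < r → ‖y‖ < r →
    ‖f x - f y‖ ≤ K * ‖x - y‖ ^ γ

/-- Two-sided version for homeomorphisms. -/
def HH {E F : Type*} [NormedAddCommGroup E] [NormedAddCommGroup F] (β : ℝ) (h : E ≃ₜ F) : Prop :=
  h 0 = 0 ∧ Hol β h ∧ Hol β h.symm

lemma Hol.comp {E F G : Type*} [NormedAddCommGroup E] [NormedAddCommGroup F]
    [NormedAddCommGroup G] {β₁ β₂ : ℝ} (h1 : 0 < β₁) {f : E → F} {g : F → G}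
    (hf : Hol β₁ f) (hg : Hol β₂ g) (hf0 : f 0 = 0) (hfc : Continuous f) :
    Hol (β₁ * β₂) (g ∘ f) := by
  intro γ hγ0 hγ
  have hlt : γ / β₁ < β₂ := by rw [div_lt_iff₀ h1]; linarith [mul_comm β₁ β₂]
  obtain ⟨γ₂, ha, hb⟩ := exists_between hlt
  have hγ2 : 0 < γ₂ := lt_trans (by positivity) ha
  have hγ1 : 0 < γ / γ₂ := by positivity
  have hγ1' : γ / γ₂ < β₁ := by
    rw [div_lt_iff₀ h1] at ha
    rw [div_lt_iff₀ hγ2]; linarith [mul_comm β₁ γ₂]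
  obtain ⟨r1, hr1, K1, hK1, H1⟩ := hf _ hγ1 hγ1'
  obtain ⟨r2, hr2, K2, hK2, H2⟩ := hg _ hγ2 hb
  have hc : ∀ᶠ x in 𝓝 (0 : E), ‖f x‖ < r2 := by
    have : Tendsto (fun x => ‖f x‖) (𝓝 0) (𝓝 0) := by
      have := (hfc.norm).tendsto 0
      simpa [hf0] using this
    exact this.eventually (gt_mem_nhds hr2)
  obtain ⟨r3, hr3, H3⟩ := Metric.eventually_nhds_iff.1 hc
  refine ⟨min r1 r3, lt_min hr1 hr3, K2 * K1 ^ γ₂, by positivity, fun x y hx hy => ?_⟩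
  have hx' := lt_min_iff.1 hx
  have hy' := lt_min_iff.1 hy
  have a := H1 x y hx'.1 hy'.1
  have b := H2 (f x) (f y) (H3 (by simpa using hx'.2)) (H3 (by simpa using hy'.2))
  calc ‖(g ∘ f) x - (g ∘ f) y‖ ≤ K2 * ‖f x - f y‖ ^ γ₂ := b
    _ ≤ K2 * (K1 * ‖x - y‖ ^ (γ / γ₂)) ^ γ₂ := by gcongr
    _ = K2 * K1 ^ γ₂ * ‖x - y‖ ^ γ := by
        rw [Real.mul_rpow hK1 (by positivity), ← Real.rpow_mul (norm_nonneg _),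
          div_mul_cancel₀ _ hγ2.ne', mul_assoc]

lemma HH.symm {E F : Type*} [NormedAddCommGroup E] [NormedAddCommGroup F] {β : ℝ}
    {h : E ≃ₜ F} (H : HH β h) : HH β h.symm :=
  ⟨by rw [Homeomorph.symm_apply_eq]; exact H.1.symm, H.2.2, by simpa using H.2.1⟩

lemma HH.trans {E F G : Type*} [NormedAddCommGroup E] [NormedAddCommGroup F]
    [NormedAddCommGroup G] {β₁ β₂ : ℝ} (h1 : 0 < β₁) (h2 : 0 < β₂) {f : E ≃ₜ F} {g : F ≃ₜ G}
    (hf : HH β₁ f) (hg : HH β₂ g) : HH (β₁ * β₂) (f.trans g) := by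
  refine ⟨by simp [hf.1, hg.1], ?_, ?_⟩
  · have := Hol.comp h1 hf.2.1 hg.2.1 hf.1 f.continuous
    exact this
  · rw [mul_comm]
    have := Hol.comp h2 hg.2.2 hf.2.2 hg.symm.1 g.symm.continuous
    exact this

lemma Hol.clm {E F : Type*} [NormedAddCommGroup E] [NormedAddCommGroup F]
    [NormedSpace ℝ E] [NormedSpace ℝ F] (L : E →L[ℝ] F) : Hol 1 L := by
  intro γ h0 h1
  refine ⟨1 / 2, by norm_num, ‖L‖, by positivity, fun x y hx hy => ?_⟩
  have hd : ‖x - y‖ ≤ 1 := (norm_sub_le x y).trans (by linarith)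
  calc ‖L x - L y‖ = ‖L (x - y)‖ := by simp
    _ ≤ ‖L‖ * ‖x - y‖ := L.le_opNorm _
    _ ≤ ‖L‖ * ‖x - y‖ ^ γ := by
        gcongr
        exact Real.self_le_rpow_of_le_one (norm_nonneg _) hd h1.le

lemma HH.cle {E F : Type*} [NormedAddCommGroup E] [NormedAddCommGroup F]
    [NormedSpace ℝ E] [NormedSpace ℝ F] (L : E ≃L[ℝ] F) : HH 1 L.toHomeomorph :=
  ⟨by simp, Hol.clm (L : E →L[ℝ] F), Hol.clm (L.symm : F →L[ℝ] E)⟩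

lemma Hol.pi {ι : Type*} [Fintype ι] {E F : ι → Type*} [∀ i, NormedAddCommGroup (E i)]
    [∀ i, NormedAddCommGroup (F i)] {β : ℝ} {f : ∀ i, E i → F i} (hf : ∀ i, Hol β (f i)) :
    Hol β (fun (x : ∀ i, E i) i => f i (x i)) := by
  intro γ h0 h1
  choose r hr K hK H using fun i => hf i γ h0 h1
  obtain ⟨r0, hr0, hr0'⟩ : ∃ r0 > (0 : ℝ), ∀ i, r0 ≤ r i := by
    rcases isEmpty_or_nonempty ι with h | h
    · exact ⟨1, one_pos, fun i => h.elim i⟩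
    · obtain ⟨i, hi⟩ := Finite.exists_min r
      exact ⟨r i, hr i, hi⟩
  refine ⟨r0, hr0, ∑ i, K i, Finset.sum_nonneg fun i _ => hK i, fun x y hx hy => ?_⟩
  have hS : (0 : ℝ) ≤ ∑ i, K i := Finset.sum_nonneg fun i _ => hK i
  rw [pi_norm_le_iff_of_nonneg (by positivity)]
  intro i
  have a := H i (x i) (y i) (((norm_le_pi_norm x i).trans_lt hx).trans_le (hr0' i))
    (((norm_le_pi_norm y i).trans_lt hy).trans_le (hr0' i))
  refine a.trans ?_
  have b : ‖x i - y i‖ ≤ ‖x - y‖ := norm_le_pi_norm (x - y) i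
  have c : K i ≤ ∑ i, K i := Finset.single_le_sum (fun i _ => hK i) (Finset.mem_univ i)
  gcongr

lemma HH.pi {ι : Type*} [Fintype ι] {E F : ι → Type*} [∀ i, NormedAddCommGroup (E i)]
    [∀ i, NormedAddCommGroup (F i)] {β : ℝ} {f : ∀ i, E i ≃ₜ F i} (hf : ∀ i, HH β (f i)) :
    HH β (Homeomorph.piCongrRight f) :=
  ⟨by ext i; exact (hf i).1, Hol.pi fun i => (hf i).2.1, Hol.pi fun i => (hf i).2.2⟩


/-- A linear flow which is uniformly expanding with respect to the seminorm `q`. -/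
structure AdFlow {E : Type*} [AddCommGroup E] [Module ℝ E] (q : Seminorm ℝ E)
    (Φ : ℝ → E →ₗ[ℝ] E) : Prop where
  zero : ∀ x, Φ 0 x = x
  add : ∀ s t x, Φ (s + t) x = Φ s (Φ t x)
  contr : ∃ c > (0 : ℝ), ∀ t ≥ (0 : ℝ), ∀ x, q (Φ (-t) x) ≤ Real.exp (-(c * t)) * q x
  lip : ∃ T > (0 : ℝ), ∃ L ≥ (0 : ℝ), ∀ t, |t| ≤ T → ∀ x, q (Φ t x - x) ≤ L * |t| * q x
  ndeg : ∀ x, q x = 0 → x = 0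

namespace AdFlow

variable {E : Type*} [AddCommGroup E] [Module ℝ E] {q : Seminorm ℝ E}
  {Φ Ψ : ℝ → E →ₗ[ℝ] E}

lemma neg_self (h : AdFlow q Φ) (t : ℝ) (x : E) : Φ (-t) (Φ t x) = x := by
  rw [← h.add]; simp [h.zero]

lemma self_neg (h : AdFlow q Φ) (t : ℝ) (x : E) : Φ t (Φ (-t) x) = x := by
  rw [← h.add]; simp [h.zero]

lemma pos (h : AdFlow q Φ) {x : E} (hx : x ≠ 0) : 0 < q x :=
  lt_of_le_of_ne (apply_nonneg q x) fun h0 => hx (h.ndeg x h0.symm)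

lemma flow_ne (h : AdFlow q Φ) {x : E} (hx : x ≠ 0) (t : ℝ) : Φ t x ≠ 0 := fun h0 => hx (by
  have := h.neg_self t x
  rw [h0, map_zero] at this
  exact this.symm)

lemma cont (h : AdFlow q Φ) (x : E) : Continuous fun t => q (Φ t x) := by
  obtain ⟨T, hT, L, hL, H⟩ := h.lip
  rw [continuous_iff_continuousAt]
  intro t
  rw [ContinuousAt, tendsto_iff_norm_sub_tendsto_zero]
  have h1 : Tendsto (fun s => L * |s - t| * q (Φ t x)) (𝓝 t) (𝓝 0) := by
    have : Continuous fun s => L * |s - t| * q (Φ t x) := by fun_prop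
    simpa using this.tendsto t
  refine squeeze_zero_norm' ?_ h1
  filter_upwards [Metric.ball_mem_nhds t hT] with s hs
  rw [Metric.mem_ball, Real.dist_eq] at hs
  have := H (s - t) hs.le (Φ t x)
  rw [← h.add] at this
  simp only [sub_add_cancel] at this
  rw [norm_norm, Real.norm_eq_abs]
  exact (abs_sub_map_le_sub q _ _).trans this

lemma exists_tau (h : AdFlow q Φ) {x : E} (hx : x ≠ 0) : ∃ τ : ℝ, q (Φ (-τ) x) = 1 := by
  obtain ⟨c, hc, H⟩ := h.contr
  have hq := h.pos hx
  have hcont : Continuous fun t => q (Φ (-t) x) := (h.cont x).comp continuous_neg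
  have h1 : ∃ t, q (Φ (-t) x) ≤ 1 := by
    refine ⟨|Real.log (q x)| / c, (H _ (by positivity) x).trans ?_⟩
    rw [mul_div_cancel₀ _ hc.ne']
    calc Real.exp (-|Real.log (q x)|) * q x
        = Real.exp (-|Real.log (q x)| + Real.log (q x)) := by
          rw [Real.exp_add, Real.exp_log hq]
      _ ≤ 1 := by
          rw [Real.exp_le_one_iff]; linarith [le_abs_self (Real.log (q x))]
  have h2 : ∃ t, 1 ≤ q (Φ (-t) x) := by
    refine ⟨-(|Real.log (q x)| / c), ?_⟩
    have := H (|Real.log (q x)| / c) (by positivity) (Φ (|Real.log (q x)| / c) x)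
    rw [h.neg_self, mul_div_cancel₀ _ hc.ne'] at this
    rw [neg_neg]
    set Q := q (Φ (|Real.log (q x)| / c) x)
    have e : Real.exp (|Real.log (q x)|) * q x ≤ Q := by
      calc _ ≤ Real.exp (|Real.log (q x)|) * (Real.exp (-|Real.log (q x)|) * Q) := by gcongr
        _ = Q := by rw [← mul_assoc, ← Real.exp_add]; simp
    refine le_trans ?_ e
    calc (1 : ℝ) ≤ Real.exp (|Real.log (q x)| + Real.log (q x)) := by
          rw [Real.one_le_exp_iff]; linarith [neg_abs_le (Real.log (q x))]
      _ = _ := by rw [Real.exp_add, Real.exp_log hq]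
  obtain ⟨a, ha⟩ := h1
  obtain ⟨b, hb⟩ := h2
  exact mem_range_of_exists_le_of_exists_ge hcont ⟨a, ha⟩ ⟨b, hb⟩

end AdFlow

/-- The hitting time of the unit sphere of `q`. -/
def tau {E : Type*} [AddCommGroup E] [Module ℝ E] (q : Seminorm ℝ E)
    (Φ : ℝ → E →ₗ[ℝ] E) (x : E) : ℝ :=
  open Classical in if h : ∃ τ : ℝ, q (Φ (-τ) x) = 1 then h.choose else 0

/-- The conjugacy between two expanding flows which is the identity on the sphere of `q`. -/
def conjMap {E : Type*} [AddCommGroup E] [Module ℝ E] (q : Seminorm ℝ E)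
    (Φ Ψ : ℝ → E →ₗ[ℝ] E) (x : E) : E := Ψ (tau q Φ x) (Φ (-(tau q Φ x)) x)

namespace AdFlow

variable {E : Type*} [AddCommGroup E] [Module ℝ E] {q : Seminorm ℝ E}
  {Φ Ψ : ℝ → E →ₗ[ℝ] E}

lemma tau_spec (h : AdFlow q Φ) {x : E} (hx : x ≠ 0) : q (Φ (-(tau q Φ x)) x) = 1 := by
  have := h.exists_tau hx
  unfold tau
  rw [dif_pos this]
  exact this.choose_spec

/-- The quantitative bound on the hitting time. -/
lemma abs_le (h : AdFlow q Φ) : ∃ c > (0 : ℝ), ∀ (x : E) (τ : ℝ), x ≠ 0 → q (Φ (-τ) x) = 1 →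
    c * |τ| ≤ |Real.log (q x)| ∧ (q x < 1 → τ ≤ 0) := by
  obtain ⟨c, hc, H⟩ := h.contr
  refine ⟨c, hc, fun x τ hx hτ => ?_⟩
  have hq := h.pos hx
  rcases le_total 0 τ with h0 | h0
  · have := H τ h0 x
    rw [hτ] at this
    have h2 := Real.log_le_log one_pos this
    rw [Real.log_one, Real.log_mul (Real.exp_pos _).ne' hq.ne', Real.log_exp] at h2
    rw [abs_of_nonneg h0]
    refine ⟨by linarith [le_abs_self (Real.log (q x))], fun h1 => ?_⟩
    have := Real.log_neg hq h1
    by_contra hcon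
    push Not at hcon
    nlinarith
  · have := H (-τ) (by linarith) (Φ (-τ) x)
    rw [hτ, h.neg_self] at this
    have h2 := Real.log_le_log hq this
    rw [mul_one, Real.log_exp] at h2
    rw [abs_of_nonpos h0]
    exact ⟨by linarith [neg_abs_le (Real.log (q x))], fun _ => h0⟩

lemma tau_unique (h : AdFlow q Φ) {x : E} (hx : x ≠ 0) {t : ℝ} (ht : q (Φ (-t) x) = 1) :
    tau q Φ x = t := by
  obtain ⟨c, hc, H⟩ := h.abs_le
  have h1 := h.tau_spec hx
  set τ := tau q Φ x
  have := (H (Φ (-t) x) (τ - t) (h.flow_ne hx _) (by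
    rw [← h.add]; rw [← h1]; congr 2; ring_nf)).1
  rw [ht, Real.log_one, abs_zero] at this
  have : |τ - t| ≤ 0 := by
    by_contra hcon
    push Not at hcon
    nlinarith
  have := abs_nonpos_iff.1 this
  linarith

lemma tau_flow (h : AdFlow q Φ) {x : E} (hx : x ≠ 0) (t : ℝ) :
    tau q Φ (Φ t x) = t + tau q Φ x := by
  refine h.tau_unique (h.flow_ne hx t) ?_
  rw [← h.add, ← h.tau_spec hx]; congr 2; ring_nf

lemma conj_zero : conjMap q Φ Ψ 0 = 0 := by simp [conjMap]

lemma conj_flow (h : AdFlow q Φ) (h' : AdFlow q Ψ) (t : ℝ) (x : E) :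
    conjMap q Φ Ψ (Φ t x) = Ψ t (conjMap q Φ Ψ x) := by
  by_cases hx : x = 0
  · simp [hx, conj_zero]
  · rw [conjMap, conjMap, h.tau_flow hx, ← h.add, h'.add]
    congr 4; ring_nf

lemma conj_inv (h : AdFlow q Φ) (h' : AdFlow q Ψ) (x : E) :
    conjMap q Ψ Φ (conjMap q Φ Ψ x) = x := by
  by_cases hx : x = 0
  · simp [hx, conj_zero]
  · have hs := h.tau_spec hx
    have hn : conjMap q Φ Ψ x ≠ 0 := h'.flow_ne (h.flow_ne hx _) _
    have : tau q Ψ (conjMap q Φ Ψ x) = tau q Φ x := by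
      refine h'.tau_unique hn ?_
      rw [conjMap, h'.neg_self, hs]
    rw [conjMap, this, conjMap, h'.neg_self, h.self_neg]

/-- Lipschitz bound near the unit sphere. -/
lemma near (h : AdFlow q Φ) (h' : AdFlow q Ψ) : ∃ δ₀ > (0 : ℝ), δ₀ < 1 ∧ ∃ K ≥ (0 : ℝ),
    ∀ x y : E, q x = 1 → q (x - y) ≤ δ₀ →
      q (conjMap q Φ Ψ x - conjMap q Φ Ψ y) ≤ K * q (x - y) := by
  obtain ⟨c, hc, H⟩ := h.abs_le
  obtain ⟨T₁, hT₁, L₁, hL₁, H₁⟩ := h.lip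
  obtain ⟨T₂, hT₂, L₂, hL₂, H₂⟩ := h'.lip
  set T := min T₁ T₂
  have hT : 0 < T := lt_min hT₁ hT₂
  refine ⟨min (1 / 2) (c * T / 2), by positivity,
    lt_of_le_of_lt (min_le_left _ _) (by norm_num),
    1 + ((1 + L₂ * T) * L₁ + L₂) * (2 / c) * 2, by positivity, fun x y hx hd => ?_⟩
  set δ := q (x - y) with hδ
  have hδ0 : 0 ≤ δ := apply_nonneg q _
  have hδ1 : δ ≤ 1 / 2 := hd.trans (min_le_left _ _)
  have hδ2 : δ ≤ c * T / 2 := hd.trans (min_le_right _ _)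
  have hqy1 : q y ≤ 1 + δ := by
    have : q y ≤ q x + q (x - y) := by
      have := map_sub_le_add q x (x - y)
      simpa using this
    linarith
  have hqy2 : 1 - δ ≤ q y := by
    have : q x ≤ q (x - y) + q y := by
      have := map_add_le_add q (x - y) y
      simpa using this
    linarith
  have hqy : 0 < q y := by linarith
  have hy : y ≠ 0 := by rintro rfl; simp at hqy
  have hxne : x ≠ 0 := by rintro rfl; simp at hx
  have hlog : |Real.log (q y)| ≤ 2 * δ := by
    rw [_root_.abs_le]
    constructor
    · have := Real.one_sub_inv_le_log_of_pos hqy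
      have h3 : (q y)⁻¹ ≤ 1 + 2 * δ := by
        rw [inv_le_comm₀ hqy (by linarith)]
        refine le_trans ?_ hqy2
        rw [inv_le_iff_one_le_mul₀ (by linarith)]
        nlinarith
      linarith
    · have := Real.log_le_sub_one_of_pos hqy
      linarith
  have hτx : tau q Φ x = 0 := h.tau_unique hxne (by simp [h.zero, hx])
  have hcx : conjMap q Φ Ψ x = x := by simp [conjMap, hτx, h.zero, h'.zero]
  set σ := tau q Φ y with hσ
  have hσ1 : c * |σ| ≤ 2 * δ := ((H y σ hy (h.tau_spec hy)).1).trans hlog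
  have hσ2 : |σ| ≤ 2 / c * δ := by
    rw [div_mul_eq_mul_div, le_div_iff₀ hc]; linarith
  have hσT : |σ| ≤ T := by
    refine le_of_mul_le_mul_left ?_ hc
    linarith
  have e1 : q (Φ (-σ) y - y) ≤ L₁ * |σ| * q y := by
    have := H₁ (-σ) (by rw [abs_neg]; exact hσT.trans (min_le_left _ _)) y
    rwa [abs_neg] at this
  have e2 : q (Ψ σ y - y) ≤ L₂ * |σ| * q y := H₂ σ (hσT.trans (min_le_right _ _)) y
  have e3 : ∀ z, q (Ψ σ z) ≤ (1 + L₂ * T) * q z := by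
    intro z
    have a := H₂ σ (hσT.trans (min_le_right _ _)) z
    have b : q (Ψ σ z) ≤ q (Ψ σ z - z) + q z := by
      have := map_add_le_add q (Ψ σ z - z) z
      simpa using this
    have c' : L₂ * |σ| * q z ≤ L₂ * T * q z := by
      have := apply_nonneg q z
      gcongr
    linarith
  rw [hcx]
  have e4 : q (conjMap q Φ Ψ y - y) ≤ ((1 + L₂ * T) * L₁ + L₂) * |σ| * q y := by
    have : conjMap q Φ Ψ y - y = Ψ σ (Φ (-σ) y - y) + (Ψ σ y - y) := by
      rw [map_sub]; simp only [conjMap]; abel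
    rw [this]
    refine (map_add_le_add q _ _).trans ?_
    have := (e3 (Φ (-σ) y - y)).trans (mul_le_mul_of_nonneg_left e1 (by positivity))
    linarith
  have e5 : q (x - conjMap q Φ Ψ y) ≤ δ + q (conjMap q Φ Ψ y - y) := by
    have := map_sub_le_add q (x - y) (conjMap q Φ Ψ y - y)
    simpa using this
  have e6 : ((1 + L₂ * T) * L₁ + L₂) * |σ| * q y ≤
      ((1 + L₂ * T) * L₁ + L₂) * (2 / c * δ) * 2 := by
    gcongr
    linarith
  linarith

/-- The basic dichotomy behind the Hölder estimate. -/
lemma dichotomy (h : AdFlow q Φ) (h' : AdFlow q Ψ) {a b : ℝ}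
    (hΦ : ∀ ε > (0 : ℝ), ∃ C > (0 : ℝ), ∀ t ≥ (0 : ℝ), ∀ x,
      q (Φ t x) ≤ C * Real.exp ((a + ε) * t) * q x)
    (hΨ : ∀ ε > (0 : ℝ), ∃ C > (0 : ℝ), ∀ t ≥ (0 : ℝ), ∀ x,
      q (Ψ (-t) x) ≤ C * Real.exp ((-b + ε) * t) * q x)
    {γ : ℝ} (hγ0 : 0 < γ) (hγ1 : γ ≤ 1) (hγ : γ * a < b) :
    ∃ K ≥ (0 : ℝ), ∀ x y : E, x ≠ 0 → q x < 1 →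
      q (conjMap q Φ Ψ x - conjMap q Φ Ψ y) ≤ K * q (x - y) ^ γ ∨
      q (conjMap q Φ Ψ x) ≤ K * q (x - y) ^ γ := by
  set ε := (b - γ * a) / 2 with hε
  have hε0 : 0 < ε := by rw [hε]; linarith
  obtain ⟨C₁, hC₁, H₁⟩ := hΦ ε hε0
  obtain ⟨C₂, hC₂, H₂⟩ := hΨ ε hε0
  obtain ⟨δ₀, hδ₀, hδ₀1, K, hK, H⟩ := h.near h'
  obtain ⟨c, hc, Hc⟩ := h.abs_le
  refine ⟨C₂ * (K + δ₀⁻¹ ^ γ) * C₁ ^ γ, by positivity, fun x y hx hx1 => ?_⟩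
  set τ := tau q Φ x with hτ
  have hs := h.tau_spec hx
  rw [← hτ] at hs
  have hτ0 : τ ≤ 0 := (Hc x τ hx hs).2 hx1
  set u := -τ with hu
  have hu0 : 0 ≤ u := by linarith
  have hτu : τ = -u := by linarith
  set δ := q (Φ u x - Φ u y) with hδ
  have hδ0 : 0 ≤ δ := apply_nonneg q _
  have hδ1 : δ ≤ C₁ * Real.exp ((a + ε) * u) * q (x - y) := by
    have := H₁ u hu0 (x - y)
    rwa [map_sub] at this
  have hqn : 0 ≤ q (x - y) := apply_nonneg q _
  -- the common final estimate
  have fin : C₂ * Real.exp ((-b + ε) * u) * ((K + δ₀⁻¹ ^ γ) * δ ^ γ) ≤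
      C₂ * (K + δ₀⁻¹ ^ γ) * C₁ ^ γ * q (x - y) ^ γ := by
    have e1 : δ ^ γ ≤ C₁ ^ γ * Real.exp ((a + ε) * u * γ) * q (x - y) ^ γ := by
      calc δ ^ γ ≤ (C₁ * Real.exp ((a + ε) * u) * q (x - y)) ^ γ := by gcongr
        _ = _ := by
          rw [Real.mul_rpow (by positivity) hqn, Real.mul_rpow hC₁.le (by positivity),
            ← Real.exp_mul]
    have e2 : Real.exp ((-b + ε) * u) * Real.exp ((a + ε) * u * γ) ≤ 1 := by
      rw [← Real.exp_add, Real.exp_le_one_iff]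
      have : (-b + ε) * u + (a + ε) * u * γ = -((1 - γ) * ε * u) := by rw [hε]; ring
      rw [this]
      have : 0 ≤ (1 - γ) * ε * u := by
        have : 0 ≤ 1 - γ := by linarith
        positivity
      linarith
    calc _ ≤ C₂ * Real.exp ((-b + ε) * u) * ((K + δ₀⁻¹ ^ γ) *
          (C₁ ^ γ * Real.exp ((a + ε) * u * γ) * q (x - y) ^ γ)) := by gcongr
      _ = (C₂ * (K + δ₀⁻¹ ^ γ) * C₁ ^ γ * q (x - y) ^ γ) *
          (Real.exp ((-b + ε) * u) * Real.exp ((a + ε) * u * γ)) := by ring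
      _ ≤ (C₂ * (K + δ₀⁻¹ ^ γ) * C₁ ^ γ * q (x - y) ^ γ) * 1 := by gcongr
      _ = _ := mul_one _
  have back : ∀ z, conjMap q Φ Ψ z = Ψ (-u) (conjMap q Φ Ψ (Φ u z)) := by
    intro z
    rw [h.conj_flow h', h'.neg_self]
  rcases le_or_gt δ δ₀ with hcase | hcase
  · left
    have n := H (Φ u x) (Φ u y) hs hcase
    rw [back x, back y, ← map_sub]
    refine (H₂ u hu0 _).trans (le_trans ?_ fin)
    have : δ ≤ δ ^ γ := Real.self_le_rpow_of_le_one hδ0 (by linarith) hγ1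
    have h3 : K * δ ≤ (K + δ₀⁻¹ ^ γ) * δ ^ γ := by
      have : 0 ≤ δ₀⁻¹ ^ γ := by positivity
      calc K * δ ≤ K * δ ^ γ := by gcongr
        _ ≤ _ := by gcongr; linarith
    have := n.trans h3
    gcongr
  · right
    have e : conjMap q Φ Ψ x = Ψ (-u) (Φ u x) := by rw [conjMap, ← hτ, ← hτu]
    rw [e]
    refine (H₂ u hu0 _).trans (le_trans ?_ fin)
    rw [hs]
    have : 1 ≤ (K + δ₀⁻¹ ^ γ) * δ ^ γ := by
      have e1 : 1 ≤ δ₀⁻¹ ^ γ * δ ^ γ := by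
        rw [← Real.mul_rpow (by positivity) hδ0]
        refine Real.one_le_rpow ?_ hγ0.le
        rw [inv_mul_eq_div, one_le_div hδ₀]; exact hcase.le
      have e2 : 0 ≤ K * δ ^ γ := by positivity
      linarith
    gcongr

lemma holder (h : AdFlow q Φ) (h' : AdFlow q Ψ) {a b : ℝ}
    (hΦ : ∀ ε > (0 : ℝ), ∃ C > (0 : ℝ), ∀ t ≥ (0 : ℝ), ∀ x,
      q (Φ t x) ≤ C * Real.exp ((a + ε) * t) * q x)
    (hΨ : ∀ ε > (0 : ℝ), ∃ C > (0 : ℝ), ∀ t ≥ (0 : ℝ), ∀ x,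
      q (Ψ (-t) x) ≤ C * Real.exp ((-b + ε) * t) * q x)
    {γ : ℝ} (hγ0 : 0 < γ) (hγ1 : γ ≤ 1) (hγ : γ * a < b) :
    ∃ K ≥ (0 : ℝ), ∀ x y : E, q x < 1 → q y < 1 →
      q (conjMap q Φ Ψ x - conjMap q Φ Ψ y) ≤ K * q (x - y) ^ γ := by
  obtain ⟨K, hK, H⟩ := h.dichotomy h' hΦ hΨ hγ0 hγ1 hγ
  refine ⟨2 * K, by positivity, fun x y hx hy => ?_⟩
  have hp : 0 ≤ K * q (x - y) ^ γ := by have := apply_nonneg q (x - y); positivity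
  have hsymm : q (y - x) = q (x - y) := map_sub_rev q y x
  by_cases hx0 : x = 0
  · by_cases hy0 : y = 0
    · subst hx0 hy0; simp [conj_zero, hγ0.ne']
    · subst hx0
      have := H y 0 hy0 hy
      rw [conj_zero, sub_zero, or_self, hsymm] at this
      rw [conj_zero, map_sub_rev, sub_zero]
      linarith
  · rcases H x y hx0 hx with h1 | h1
    · linarith
    · by_cases hy0 : y = 0
      · subst hy0; rw [conj_zero, sub_zero]; linarith
      · rcases H y x hy0 hy with h2 | h2
        · rw [map_sub_rev]; rw [hsymm] at h2; linarith
        · rw [hsymm] at h2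
          have := map_sub_le_add q (conjMap q Φ Ψ x) (conjMap q Φ Ψ y)
          linarith

end AdFlow

/-- Exponential growth rate `a`, up to subexponential errors. -/
def Gr {E : Type*} [AddCommGroup E] [Module ℝ E] (q : E → ℝ)
    (Φ : ℝ → E →ₗ[ℝ] E) (a : ℝ) : Prop :=
  ∀ ε > (0 : ℝ), ∃ C > (0 : ℝ), ∀ t x, q (Φ t x) ≤ C * Real.exp (a * t + ε * |t|) * q x

section
variable {E : Type*} [NormedAddCommGroup E] [NormedSpace ℝ E] {q : Seminorm ℝ E}
  {Φ Ψ : ℝ → E →ₗ[ℝ] E}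

lemma Gr.pos {a : ℝ} (h : Gr q Φ a) : ∀ ε > (0 : ℝ), ∃ C > (0 : ℝ), ∀ t ≥ (0 : ℝ), ∀ x,
      q (Φ t x) ≤ C * Real.exp ((a + ε) * t) * q x := by
  intro ε hε
  obtain ⟨C, hC, H⟩ := h ε hε
  refine ⟨C, hC, fun t ht x => ?_⟩
  have := H t x
  rwa [abs_of_nonneg ht, ← add_mul] at this

lemma Gr.neg {a : ℝ} (h : Gr q Φ a) : ∀ ε > (0 : ℝ), ∃ C > (0 : ℝ), ∀ t ≥ (0 : ℝ), ∀ x,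
      q (Φ (-t) x) ≤ C * Real.exp ((-a + ε) * t) * q x := by
  intro ε hε
  obtain ⟨C, hC, H⟩ := h ε hε
  refine ⟨C, hC, fun t ht x => ?_⟩
  have := H (-t) x
  rw [abs_neg, abs_of_nonneg ht] at this
  convert this using 4
  ring

lemma AdFlow.norm_holder {C : ℝ} (hC : 0 < C) (hq1 : ∀ x, q x ≤ C * ‖x‖)
    (hq2 : ∀ x, ‖x‖ ≤ C * q x) (h : AdFlow q Φ) (h' : AdFlow q Ψ) {a b : ℝ}
    (ha : Gr q Φ a) (hb : Gr q Ψ b) {γ : ℝ} (hγ0 : 0 < γ) (hγ1 : γ ≤ 1) (hγ : γ * a < b) :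
    ∃ K ≥ (0 : ℝ), ∀ x y : E, q x < 1 → q y < 1 →
      ‖conjMap q Φ Ψ x - conjMap q Φ Ψ y‖ ≤ K * ‖x - y‖ ^ γ := by
  obtain ⟨K, hK, H⟩ := h.holder h' ha.pos hb.neg hγ0 hγ1 hγ
  refine ⟨C * K * C ^ γ, by positivity, fun x y hx hy => ?_⟩
  have hn : 0 ≤ q (x - y) := apply_nonneg q _
  calc _ ≤ C * q (conjMap q Φ Ψ x - conjMap q Φ Ψ y) := hq2 _
    _ ≤ C * (K * q (x - y) ^ γ) := by gcongr; exact H x y hx hy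
    _ ≤ C * (K * (C * ‖x - y‖) ^ γ) := by gcongr; exact hq1 _
    _ = _ := by rw [Real.mul_rpow hC.le (norm_nonneg _)]; ring

lemma AdFlow.hol {C : ℝ} (hC : 0 < C) (hq1 : ∀ x, q x ≤ C * ‖x‖)
    (hq2 : ∀ x, ‖x‖ ≤ C * q x) (h : AdFlow q Φ) (h' : AdFlow q Ψ) {a b : ℝ}
    (ha : Gr q Φ a) (hb : Gr q Ψ b) (ha0 : 0 < a) {β : ℝ} (hβ1 : β ≤ 1) (hβ : β * a ≤ b) :
    Hol β (conjMap q Φ Ψ) := by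
  intro γ h0 h1
  obtain ⟨K, hK, H⟩ := h.norm_holder hC hq1 hq2 h' ha hb h0 (h1.le.trans hβ1) (by nlinarith)
  refine ⟨1 / C, by positivity, K, hK, fun x y hx hy => H x y ?_ ?_⟩
  · refine (hq1 x).trans_lt ?_
    rw [lt_div_iff₀ hC] at hx; linarith
  · refine (hq1 y).trans_lt ?_
    rw [lt_div_iff₀ hC] at hy; linarith

lemma AdFlow.continuous_conj [FiniteDimensional ℝ E] {C : ℝ} (hC : 0 < C)
    (hq1 : ∀ x, q x ≤ C * ‖x‖)
    (hq2 : ∀ x, ‖x‖ ≤ C * q x) (h : AdFlow q Φ) (h' : AdFlow q Ψ) {a b : ℝ}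
    (ha : Gr q Φ a) (hb : Gr q Ψ b) (ha0 : 0 < a) (hb0 : 0 < b) :
    Continuous (conjMap q Φ Ψ) := by
  have hqc : Continuous q := by
    rw [continuous_iff_continuousAt]
    intro x
    rw [ContinuousAt, tendsto_iff_norm_sub_tendsto_zero]
    have h1 : Tendsto (fun s => C * ‖s - x‖) (𝓝 x) (𝓝 0) := by
      have : Continuous fun s => C * ‖s - x‖ := by fun_prop
      simpa using this.tendsto x
    refine squeeze_zero (fun _ => norm_nonneg _) (fun s => ?_) h1
    exact (abs_sub_map_le_sub q _ _).trans (hq1 _)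
  obtain ⟨γ, hγ0, hγ⟩ : ∃ γ > (0 : ℝ), γ ≤ 1 ∧ γ * a < b := by
    refine ⟨min 1 (b / (2 * a)), by positivity, min_le_left _ _, ?_⟩
    calc _ ≤ b / (2 * a) * a := by gcongr; exact min_le_right _ _
      _ = b / 2 := by field_simp
      _ < b := by linarith
  obtain ⟨K, hK, H⟩ := h.norm_holder hC hq1 hq2 h' ha hb hγ0 hγ.1 hγ.2
  have key : ∀ z, q z < 1 → ContinuousAt (conjMap q Φ Ψ) z := by
    intro z hz
    rw [ContinuousAt, tendsto_iff_norm_sub_tendsto_zero]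
    have h1 : Tendsto (fun s => K * ‖s - z‖ ^ γ) (𝓝 z) (𝓝 0) := by
      have : Continuous fun s => K * ‖s - z‖ ^ γ := by
        refine continuous_const.mul (Continuous.rpow_const (by fun_prop) fun _ => Or.inr hγ0.le)
      have := this.tendsto z
      simpa [hγ0.ne'] using this
    refine squeeze_zero' (Eventually.of_forall fun _ => norm_nonneg _) ?_ h1
    filter_upwards [(hqc.tendsto z).eventually (gt_mem_nhds hz)] with s hs
    exact H s z hs hz
  rw [continuous_iff_continuousAt]
  intro x
  obtain ⟨c, hc, Hc⟩ := h.contr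
  obtain ⟨t, ht⟩ : ∃ t, q (Φ (-t) x) < 1 := by
    have h1 : Tendsto (fun t : ℝ => Real.exp (-(c * t)) * q x) atTop (𝓝 (0 * q x)) := by
      refine Tendsto.mul_const _ ?_
      refine Real.tendsto_exp_neg_atTop_nhds_zero.comp (tendsto_id.const_mul_atTop hc)
    rw [zero_mul] at h1
    obtain ⟨t, h2, h3⟩ := ((h1.eventually (gt_mem_nhds one_pos)).and (eventually_ge_atTop 0)).exists
    exact ⟨t, (Hc t h3 x).trans_lt h2⟩
  have e : conjMap q Φ Ψ = fun x => Ψ t (conjMap q Φ Ψ (Φ (-t) x)) := by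
    funext x
    rw [h.conj_flow h', h'.self_neg]
  rw [e]
  have c1 : Continuous (Ψ t) := LinearMap.continuous_of_finiteDimensional _
  have c2 : Continuous (Φ (-t)) := LinearMap.continuous_of_finiteDimensional _
  exact c1.continuousAt.comp
    (ContinuousAt.comp (f := Φ (-t)) (x := x) (key _ ht) c2.continuousAt)

theorem AdFlow.block [FiniteDimensional ℝ E] {C : ℝ} (hC : 0 < C)
    (hq1 : ∀ x, q x ≤ C * ‖x‖)
    (hq2 : ∀ x, ‖x‖ ≤ C * q x) (h : AdFlow q Φ) (h' : AdFlow q Ψ) {a b : ℝ}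
    (ha : Gr q Φ a) (hb : Gr q Ψ b) (ha0 : 0 < a) (hb0 : 0 < b) {β : ℝ} (hβ1 : β ≤ 1)
    (hβ : β * a ≤ b) (hβ' : β * b ≤ a) :
    ∃ H : E ≃ₜ E, HH β H ∧ ∀ t x, H (Φ t x) = Ψ t (H x) := by
  refine ⟨⟨⟨conjMap q Φ Ψ, conjMap q Ψ Φ, h.conj_inv h', h'.conj_inv h⟩,
    h.continuous_conj hC hq1 hq2 h' ha hb ha0 hb0,
    h'.continuous_conj hC hq1 hq2 h hb ha hb0 ha0⟩, ⟨AdFlow.conj_zero, ?_, ?_⟩, ?_⟩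
  · exact h.hol hC hq1 hq2 h' ha hb ha0 hβ1 hβ
  · exact h'.hol hC hq1 hq2 h hb ha hb0 hβ1 hβ'
  · exact h.conj_flow h'

/-- The scalar flow `e^{at}`. -/
def sFlow (E : Type*) [AddCommGroup E] [Module ℝ E] (a : ℝ) (t : ℝ) : E →ₗ[ℝ] E :=
  Real.exp (a * t) • LinearMap.id

lemma sFlow_apply (a t : ℝ) (x : E) : sFlow E a t x = Real.exp (a * t) • x := rfl

lemma q_sFlow (q : Seminorm ℝ E) (a t : ℝ) (x : E) :
    q (sFlow E a t x) = Real.exp (a * t) * q x := by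
  rw [sFlow_apply, map_smul_eq_mul, Real.norm_eq_abs, abs_of_pos (Real.exp_pos _)]

lemma sFlow_gr (q : Seminorm ℝ E) (a : ℝ) : Gr q (sFlow E a) a := by
  intro ε hε
  refine ⟨1, one_pos, fun t x => ?_⟩
  rw [q_sFlow, one_mul]
  have := apply_nonneg q x
  gcongr
  have : 0 ≤ ε * |t| := by positivity
  linarith

lemma sFlow_ad (q : Seminorm ℝ E) (hq : ∀ x, q x = 0 → x = 0) {a : ℝ} (ha : 0 < a) :
    AdFlow q (sFlow E a) where
  zero x := by simp [sFlow_apply]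
  add s t x := by rw [sFlow_apply, sFlow_apply, sFlow_apply, mul_add, Real.exp_add, mul_smul]
  contr := ⟨a, ha, fun t _ x => by rw [q_sFlow, mul_neg]⟩
  lip := by
    refine ⟨1 / a, by positivity, 2 * a, by positivity, fun t ht x => ?_⟩
    have e : sFlow E a t x - x = (Real.exp (a * t) - 1) • x := by
      rw [sFlow_apply, sub_smul, one_smul]
    rw [e, map_smul_eq_mul, Real.norm_eq_abs]
    have h1 : |a * t| ≤ 1 := by
      rw [abs_mul, abs_of_pos ha]
      rw [le_div_iff₀ ha] at ht; linarith
    have := Real.abs_exp_sub_one_le h1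
    rw [abs_mul, abs_of_pos ha] at this
    have h2 := apply_nonneg q x
    calc _ ≤ (2 * (a * |t|)) * q x := by gcongr
      _ = _ := by ring
  ndeg := hq

/-- Scalar power maps. -/
theorem scalar_block {a b : ℝ} (hab : 0 < b / a) {β : ℝ} (hβ1 : β ≤ 1) (hβ : β ≤ b / a)
    (hβ' : β ≤ a / b) :
    ∃ H : ℝ ≃ₜ ℝ, HH β H ∧ ∀ t x, H (Real.exp (a * t) * x) = Real.exp (b * t) * H x := by
  have main : ∀ a b : ℝ, 0 < a → 0 < b → β ≤ b / a → β ≤ a / b →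
      ∃ H : ℝ ≃ₜ ℝ, HH β H ∧ ∀ t x, H (Real.exp (a * t) * x) = Real.exp (b * t) * H x := by
    intro a b ha hb hβ hβ'
    rw [le_div_iff₀ ha] at hβ
    rw [le_div_iff₀ hb] at hβ'
    have hq : ∀ x : ℝ, normSeminorm ℝ ℝ x = 0 → x = 0 := fun x hx => by simpa using hx
    exact AdFlow.block (q := normSeminorm ℝ ℝ) one_pos (fun x => by simp)
      (fun x => by simp) (sFlow_ad _ hq ha) (sFlow_ad _ hq hb) (sFlow_gr _ a) (sFlow_gr _ b)
      ha hb hβ1 hβ hβ'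
  rcases lt_or_gt_of_ne (show a ≠ 0 by rintro rfl; simp at hab) with ha | ha
  · have hb : b < 0 := by
      by_contra hcon
      push Not at hcon
      exact absurd hab (not_lt.2 (div_nonpos_of_nonneg_of_nonpos hcon ha.le))
    obtain ⟨H, H1, H2⟩ := main (-a) (-b) (by linarith) (by linarith)
      (by rwa [neg_div_neg_eq]) (by rwa [neg_div_neg_eq])
    refine ⟨H, H1, fun t x => ?_⟩
    have := H2 (-t) x
    simpa using this
  · have hb : 0 < b := by
      by_contra hcon
      push Not at hcon
      exact absurd hab (not_lt.2 (div_nonpos_of_nonpos_of_nonneg hcon ha.le))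
    exact main a b ha hb hβ hβ'

/-- A general linear flow (in norm). -/
structure LFlow (Φ : ℝ → E →ₗ[ℝ] E) : Prop where
  zero : ∀ x, Φ 0 x = x
  add : ∀ s t x, Φ (s + t) x = Φ s (Φ t x)
  lip : ∃ T > (0 : ℝ), ∃ L ≥ (0 : ℝ), ∀ t, |t| ≤ T → ∀ x, ‖Φ t x - x‖ ≤ L * |t| * ‖x‖

theorem block_pos [FiniteDimensional ℝ E] (h : LFlow Φ) {a : ℝ} (ha : 0 < a)
    (hg : Gr (fun x : E => ‖x‖) Φ a) :
    ∃ H : E ≃ₜ E, HH 1 H ∧ ∀ t x, H (Φ t x) = Real.exp (a * t) • H x := by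
  obtain ⟨C, hC, HC⟩ := hg (a / 2) (by positivity)
  let w : ℝ → ℝ := fun t => Real.exp (-(a * t + a / 2 * |t|))
  have hw0 : ∀ t, 0 < w t := fun t => Real.exp_pos _
  have hw : ∀ t x, w t * ‖Φ t x‖ ≤ C * ‖x‖ := by
    intro t x
    calc w t * ‖Φ t x‖ ≤ w t * (C * Real.exp (a * t + a / 2 * |t|) * ‖x‖) := by
          exact mul_le_mul_of_nonneg_left (HC t x) (hw0 t).le
      _ = (w t * Real.exp (a * t + a / 2 * |t|)) * (C * ‖x‖) := by ring
      _ = C * ‖x‖ := by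
          simp only [w]
          rw [← Real.exp_add, neg_add_cancel, Real.exp_zero, one_mul]
  have hbdd : ∀ x, BddAbove (Set.range fun t => w t * ‖Φ t x‖) := fun x =>
    ⟨C * ‖x‖, by rintro _ ⟨t, rfl⟩; exact hw t x⟩
  let q : Seminorm ℝ E := Seminorm.of (fun x => ⨆ t, w t * ‖Φ t x‖)
    (by
      intro x y
      refine ciSup_le fun t => ?_
      refine le_trans ?_ (add_le_add (le_ciSup (hbdd x) t) (le_ciSup (hbdd y) t))
      rw [map_add, ← mul_add]
      exact mul_le_mul_of_nonneg_left (norm_add_le _ _) (hw0 t).le)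
    (by
      intro c x
      rw [Real.mul_iSup_of_nonneg (norm_nonneg c)]
      congr 1
      funext t
      rw [map_smul, norm_smul]; ring)
  have hqdef : ∀ x, q x = ⨆ t, w t * ‖Φ t x‖ := fun x => rfl
  have hqle : ∀ x, q x ≤ C * ‖x‖ := fun x => ciSup_le fun t => hw t x
  have hqge : ∀ x, ‖x‖ ≤ q x := by
    intro x
    have h0 : w 0 = 1 := by simp [w]
    have : w 0 * ‖Φ 0 x‖ ≤ q x := le_ciSup (hbdd x) 0
    rwa [h0, h.zero, one_mul] at this
  have hqC : ∀ x, q x ≤ (C + 1) * ‖x‖ := fun x =>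
    (hqle x).trans (by have := norm_nonneg x; nlinarith)
  have hqC2 : ∀ x, ‖x‖ ≤ (C + 1) * q x := fun x => by
    have h1 := hqge x
    have h2 := apply_nonneg q x
    nlinarith
  have hnd : ∀ x, q x = 0 → x = 0 := by
    intro x hx
    have := hqge x
    rw [hx] at this
    exact norm_le_zero_iff.1 this
  have had : AdFlow q Φ :=
    { zero := h.zero
      add := h.add
      contr := by
        refine ⟨a / 2, by positivity, fun t ht x => ?_⟩
        rw [hqdef (Φ (-t) x)]
        refine ciSup_le fun s => ?_
        have h1 : w (s - t) * ‖Φ (s - t) x‖ ≤ q x := le_ciSup (hbdd x) (s - t)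
        rw [← h.add, ← sub_eq_add_neg]
        have h2 : w s ≤ Real.exp (-(a / 2 * t)) * w (s - t) := by
          simp only [w]
          rw [← Real.exp_add, Real.exp_le_exp]
          have : |s - t| ≤ |s| + t := by
            have := abs_sub s t
            rwa [abs_of_nonneg ht] at this
          nlinarith
        calc w s * ‖Φ (s - t) x‖ ≤ Real.exp (-(a / 2 * t)) * w (s - t) * ‖Φ (s - t) x‖ := by
              gcongr
          _ = Real.exp (-(a / 2 * t)) * (w (s - t) * ‖Φ (s - t) x‖) := by ring
          _ ≤ _ := by gcongr
      lip := by
        obtain ⟨T, hT, L, hL, H⟩ := h.lip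
        refine ⟨T, hT, C * L, by positivity, fun t ht x => ?_⟩
        calc _ ≤ C * ‖Φ t x - x‖ := hqle _
          _ ≤ C * (L * |t| * ‖x‖) := by gcongr; exact H t ht x
          _ ≤ C * (L * |t| * q x) := by gcongr; exact hqge x
          _ = _ := by ring
      ndeg := hnd }
  have hgq : Gr q Φ a := by
    intro ε hε
    obtain ⟨D, hD, HD⟩ := hg ε hε
    refine ⟨C * D, by positivity, fun t x => ?_⟩
    calc _ ≤ C * ‖Φ t x‖ := hqle _
      _ ≤ C * (D * Real.exp (a * t + ε * |t|) * ‖x‖) := by gcongr; exact HD t x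
      _ ≤ C * (D * Real.exp (a * t + ε * |t|) * q x) := by gcongr; exact hqge x
      _ = _ := by ring
  exact had.block (C := C + 1) (by positivity) hqC hqC2 (sFlow_ad q hnd ha) hgq (sFlow_gr q a)
    ha ha le_rfl (by linarith) (by linarith)

theorem block_all [FiniteDimensional ℝ E] (h : LFlow Φ) {a : ℝ} (ha : a ≠ 0)
    (hg : Gr (fun x : E => ‖x‖) Φ a) :
    ∃ H : E ≃ₜ E, HH 1 H ∧ ∀ t x, H (Φ t x) = Real.exp (a * t) • H x := by
  rcases lt_or_gt_of_ne ha with ha | ha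
  · have h' : LFlow (fun t => Φ (-t)) :=
      { zero := fun x => by simp [h.zero]
        add := fun s t x => by rw [neg_add, h.add]
        lip := by
          obtain ⟨T, hT, L, hL, H⟩ := h.lip
          refine ⟨T, hT, L, hL, fun t ht x => ?_⟩
          have := H (-t) (by rwa [abs_neg]) x
          rwa [abs_neg] at this }
    have hg' : Gr (fun x : E => ‖x‖) (fun t => Φ (-t)) (-a) := by
      intro ε hε
      obtain ⟨C, hC, H⟩ := hg ε hε
      refine ⟨C, hC, fun t x => ?_⟩
      have := H (-t) x
      rw [abs_neg] at this
      simpa using this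
    obtain ⟨H, H1, H2⟩ := block_pos h' (by linarith) hg'
    refine ⟨H, H1, fun t x => ?_⟩
    have := H2 (-t) x
    simpa using this
  · exact block_pos h ha hg

end

section
variable {E : Type*} [NormedAddCommGroup E] [NormedSpace ℝ E] {Φ : ℝ → E →ₗ[ℝ] E}

/-- The space of vectors with exponential growth rate `r` in both time directions. -/
def growSp (Φ : ℝ → E →ₗ[ℝ] E) (r : ℝ) : Submodule ℝ E where
  carrier := {x | ∀ ε > (0 : ℝ), ∃ C ≥ (0 : ℝ), ∀ t, ‖Φ t x‖ ≤ C * Real.exp (r * t + ε * |t|)}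
  add_mem' := by
    intro x y hx hy ε hε
    obtain ⟨C, hC, H⟩ := hx ε hε
    obtain ⟨D, hD, H'⟩ := hy ε hε
    refine ⟨C + D, by positivity, fun t => ?_⟩
    rw [map_add, add_mul]
    exact (norm_add_le _ _).trans (add_le_add (H t) (H' t))
  zero_mem' := fun ε _ => ⟨0, le_rfl, fun t => by simp⟩
  smul_mem' := by
    intro c x hx ε hε
    obtain ⟨C, hC, H⟩ := hx ε hε
    refine ⟨‖c‖ * C, by positivity, fun t => ?_⟩
    rw [map_smul, norm_smul, mul_assoc]
    exact mul_le_mul_of_nonneg_left (H t) (norm_nonneg _)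

lemma growSp_inv (h : LFlow Φ) (r s : ℝ) : ∀ x ∈ growSp Φ r, Φ s x ∈ growSp Φ r := by
  intro x hx ε hε
  obtain ⟨C, hC, H⟩ := hx ε hε
  refine ⟨C * Real.exp (r * s + ε * |s|), by positivity, fun t => ?_⟩
  rw [← h.add, mul_assoc, ← Real.exp_add]
  refine (H _).trans ?_
  apply mul_le_mul_of_nonneg_left _ hC
  rw [Real.exp_le_exp]
  have := mul_le_mul_of_nonneg_left (abs_add_le t s) hε.le
  linarith

/-- The restriction of the flow to a growth space. -/
def resFlow (h : LFlow Φ) (r : ℝ) (t : ℝ) : growSp Φ r →ₗ[ℝ] growSp Φ r :=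
  (Φ t).restrict (growSp_inv h r t)

lemma resFlow_coe (h : LFlow Φ) (r t : ℝ) (x : growSp Φ r) :
    (resFlow h r t x : E) = Φ t x := rfl

lemma resFlow_lflow (h : LFlow Φ) (r : ℝ) : LFlow (resFlow h r) where
  zero x := Subtype.ext (by rw [resFlow_coe, h.zero])
  add s t x := Subtype.ext (by simp only [resFlow_coe, h.add])
  lip := by
    obtain ⟨T, hT, L, hL, H⟩ := h.lip
    exact ⟨T, hT, L, hL, fun t ht x => H t ht x⟩

lemma resFlow_gr [FiniteDimensional ℝ E] (h : LFlow Φ) (r : ℝ) :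
    Gr (fun x : growSp Φ r => ‖x‖) (resFlow h r) r := by
  intro ε hε
  let g : ℝ → growSp Φ r →L[ℝ] growSp Φ r := fun t =>
    Real.exp (-(r * t + ε * |t|)) • LinearMap.toContinuousLinearMap (resFlow h r t)
  have hg : ∀ t x, g t x = Real.exp (-(r * t + ε * |t|)) • resFlow h r t x := fun t x => rfl
  have : CompleteSpace (growSp Φ r) := FiniteDimensional.complete ℝ _
  obtain ⟨C, hC⟩ := banach_steinhaus (g := g) (by
    intro x
    obtain ⟨C, hC, H⟩ := x.2 ε hε
    refine ⟨C, fun t => ?_⟩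
    rw [hg, norm_smul, Real.norm_eq_abs, abs_of_pos (Real.exp_pos _)]
    calc _ ≤ Real.exp (-(r * t + ε * |t|)) * (C * Real.exp (r * t + ε * |t|)) := by
          gcongr; exact H t
      _ = C * (Real.exp (-(r * t + ε * |t|)) * Real.exp (r * t + ε * |t|)) := by ring
      _ = C := by rw [← Real.exp_add, neg_add_cancel, Real.exp_zero, mul_one])
  refine ⟨|C| + 1, by positivity, fun t x => ?_⟩
  have h1 : ‖g t x‖ ≤ (|C| + 1) * ‖x‖ := by
    refine ((g t).le_opNorm x).trans ?_
    gcongr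
    exact (hC t).trans (by linarith [le_abs_self C])
  rw [hg, norm_smul, Real.norm_eq_abs, abs_of_pos (Real.exp_pos _)] at h1
  calc ‖resFlow h r t x‖ = Real.exp (r * t + ε * |t|) *
        (Real.exp (-(r * t + ε * |t|)) * ‖resFlow h r t x‖) := by
        rw [← mul_assoc, ← Real.exp_add, add_neg_cancel, Real.exp_zero, one_mul]
    _ ≤ Real.exp (r * t + ε * |t|) * ((|C| + 1) * ‖x‖) := by gcongr
    _ = _ := by ring

lemma grow_lower [FiniteDimensional ℝ E] (h : LFlow Φ) (r : ℝ) {ε : ℝ} (hε : 0 < ε) :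
    ∃ c > (0 : ℝ), ∀ x ∈ growSp Φ r, ∀ t ≥ (0 : ℝ),
      c * Real.exp ((r - ε) * t) * ‖x‖ ≤ ‖Φ t x‖ := by
  obtain ⟨C, hC, H⟩ := resFlow_gr h r ε hε
  refine ⟨C⁻¹, by positivity, fun x hx t ht => ?_⟩
  have h1 := H (-t) (resFlow h r t ⟨x, hx⟩)
  have h2 : resFlow h r (-t) (resFlow h r t ⟨x, hx⟩) = ⟨x, hx⟩ := by
    rw [← (resFlow_lflow h r).add, neg_add_cancel, (resFlow_lflow h r).zero]
  rw [h2, abs_neg, abs_of_nonneg ht] at h1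
  change ‖x‖ ≤ _ * ‖Φ t x‖ at h1
  calc C⁻¹ * Real.exp ((r - ε) * t) * ‖x‖
      ≤ C⁻¹ * Real.exp ((r - ε) * t) * (C * Real.exp (r * -t + ε * t) * ‖Φ t x‖) := by gcongr
    _ = (C⁻¹ * C) * (Real.exp ((r - ε) * t) * Real.exp (r * -t + ε * t)) * ‖Φ t x‖ := by ring
    _ = ‖Φ t x‖ := by
      rw [inv_mul_cancel₀ hC.ne', ← Real.exp_add]
      have : (r - ε) * t + (r * -t + ε * t) = 0 := by ring
      rw [this]; simp

lemma sum_lower [FiniteDimensional ℝ E] (h : LFlow Φ) {r₀ r₁ C : ℝ} {y w : E}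
    (hy : y ∈ growSp Φ r₀) (hy0 : y ≠ 0) (hr : r₁ < r₀)
    (hw : ∀ t ≥ (0 : ℝ), ‖Φ t w‖ ≤ C * Real.exp (r₁ * t)) {ε : ℝ} (hε : 0 < ε) :
    ∃ c > (0 : ℝ), ∀ᶠ t in atTop, c * Real.exp ((r₀ - ε) * t) ≤ ‖Φ t (y + w)‖ := by
  set ε' := min ε ((r₀ - r₁) / 2) with hε'
  have hε0 : 0 < ε' := lt_min hε (by linarith)
  obtain ⟨c, hc, H⟩ := grow_lower h r₀ hε0
  have hyn : 0 < ‖y‖ := norm_pos_iff.2 hy0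
  refine ⟨c * ‖y‖ / 2, by positivity, ?_⟩
  have hk : 0 < r₀ - ε' - r₁ := by
    have := min_le_right ε ((r₀ - r₁) / 2)
    linarith
  have ht : Tendsto (fun t : ℝ => c * ‖y‖ / 2 * Real.exp ((r₀ - ε' - r₁) * t)) atTop atTop :=
    (Real.tendsto_exp_atTop.comp (tendsto_id.const_mul_atTop hk)).const_mul_atTop (by positivity)
  filter_upwards [ht.eventually_ge_atTop C, eventually_ge_atTop 0] with t h1 h2
  have h3 := H y hy t h2
  have h4 : ‖Φ t w‖ ≤ c * ‖y‖ / 2 * Real.exp ((r₀ - ε') * t) := by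
    refine (hw t h2).trans ?_
    calc C * Real.exp (r₁ * t) ≤ c * ‖y‖ / 2 * Real.exp ((r₀ - ε' - r₁) * t) *
          Real.exp (r₁ * t) := by gcongr
      _ = _ := by rw [mul_assoc, ← Real.exp_add]; ring_nf
  have h5 : ‖Φ t y‖ ≤ ‖Φ t (y + w)‖ + ‖Φ t w‖ := by
    have := norm_sub_le (Φ t (y + w)) (Φ t w)
    rwa [← map_sub, add_sub_cancel_right] at this
  have h6 : Real.exp ((r₀ - ε) * t) ≤ Real.exp ((r₀ - ε') * t) := by
    gcongr
    exact min_le_left _ _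
  have h7 : c * ‖y‖ / 2 * Real.exp ((r₀ - ε) * t) ≤ c * ‖y‖ / 2 * Real.exp ((r₀ - ε') * t) := by
    gcongr
  linarith

lemma sum_lyap [FiniteDimensional ℝ E] (h : LFlow Φ) {r₀ r₁ C : ℝ} {y w : E}
    (hy : y ∈ growSp Φ r₀) (hy0 : y ≠ 0) (hr : r₁ < r₀)
    (hw : ∀ t ≥ (0 : ℝ), ‖Φ t w‖ ≤ C * Real.exp (r₁ * t)) :
    Tendsto (fun t => Real.log ‖Φ t (y + w)‖ / t) atTop (𝓝 r₀) := by
  rw [Metric.tendsto_nhds]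
  intro ε hε
  obtain ⟨c, hc, H⟩ := sum_lower h hy hy0 hr hw (half_pos hε)
  obtain ⟨D, hD, HD⟩ := hy (ε / 2) (half_pos hε)
  have hC0 : 0 ≤ C := by
    have := (norm_nonneg _).trans (hw 0 le_rfl)
    simpa using this
  have t1 : Tendsto (fun t : ℝ => Real.log c / t) atTop (𝓝 0) := tendsto_const_nhds.div_atTop tendsto_id
  have t2 : Tendsto (fun t : ℝ => Real.log (D + C) / t) atTop (𝓝 0) := tendsto_const_nhds.div_atTop tendsto_id
  filter_upwards [H, eventually_gt_atTop 0, t1.eventually (lt_mem_nhds (show -(ε / 2) < 0 by linarith)),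
    t2.eventually (gt_mem_nhds (half_pos hε))] with t h1 h2 h3 h4
  have hpos : 0 < ‖Φ t (y + w)‖ := lt_of_lt_of_le (by positivity) h1
  have hup : ‖Φ t (y + w)‖ ≤ (D + C) * Real.exp ((r₀ + ε / 2) * t) := by
    rw [map_add, add_mul]
    refine (norm_add_le _ _).trans (add_le_add ?_ ?_)
    · have := HD t
      rwa [abs_of_pos h2, ← add_mul] at this
    · refine (hw t h2.le).trans ?_
      gcongr
      linarith
  have hDC : 0 < D + C := by
    by_contra hcon
    push Not at hcon
    have := Real.exp_pos ((r₀ + ε / 2) * t)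
    nlinarith
  have l1 := Real.log_le_log (by positivity) h1
  have l2 := Real.log_le_log hpos hup
  rw [Real.log_mul hc.ne' (Real.exp_pos _).ne', Real.log_exp] at l1
  rw [Real.log_mul hDC.ne' (Real.exp_pos _).ne', Real.log_exp] at l2
  rw [Real.dist_eq, abs_lt]
  rw [lt_div_iff₀ h2] at h3
  rw [div_lt_iff₀ h2] at h4
  constructor
  · rw [neg_lt_sub_iff_lt_add, ← sub_lt_iff_lt_add', lt_div_iff₀ h2]
    nlinarith
  · rw [sub_lt_iff_lt_add, div_lt_iff₀ h2]
    nlinarith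

/-- A finite sum of vectors of growth rates `< r₀` has growth at most `r₁ < r₀`. -/
lemma sum_upper {ι : Type*} (s : Finset ι) (r : ι → ℝ) (x : ι → E) (r₀ : ℝ)
    (hx : ∀ i ∈ s, x i ∈ growSp Φ (r i)) (hr : ∀ i ∈ s, r i < r₀) :
    ∃ r₁ < r₀, ∃ C : ℝ, ∀ t ≥ (0 : ℝ), ‖Φ t (∑ i ∈ s, x i)‖ ≤ C * Real.exp (r₁ * t) := by
  classical
  induction s using Finset.induction_on with
  | empty => exact ⟨r₀ - 1, by linarith, 0, fun t _ => by simp⟩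
  | insert i s hi ih =>
    obtain ⟨r₁, hr₁, C, H⟩ := ih (fun j hj => hx j (Finset.mem_insert_of_mem hj))
      (fun j hj => hr j (Finset.mem_insert_of_mem hj))
    have hri := hr i (Finset.mem_insert_self _ _)
    obtain ⟨D, hD, HD⟩ := hx i (Finset.mem_insert_self _ _) ((r₀ - r i) / 2) (by linarith)
    have hC0 : 0 ≤ C := by
      have := (norm_nonneg _).trans (H 0 le_rfl)
      simpa using this
    refine ⟨max r₁ (r i + (r₀ - r i) / 2), max_lt hr₁ (by linarith), D + C, fun t ht => ?_⟩
    rw [Finset.sum_insert hi, map_add, add_mul]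
    refine (norm_add_le _ _).trans (add_le_add ?_ ?_)
    · have := HD t
      rw [abs_of_nonneg ht, ← add_mul] at this
      refine this.trans ?_
      gcongr
      exact le_max_right _ _
    · refine (H t ht).trans ?_
      gcongr
      exact le_max_left _ _

lemma growSp_indep [FiniteDimensional ℝ E] (h : LFlow Φ) : iSupIndep (growSp Φ) := by
  classical
  rw [iSupIndep_iff_finsetSum_eq_zero_imp_eq_zero]
  intro s v hv
  by_contra hcon
  push Not at hcon
  obtain ⟨hsum, i, hi, hne⟩ := hcon
  obtain ⟨r₀, hr₀, hmax⟩ := Finset.exists_max_image (s.filter fun r => v r ≠ 0) id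
    ⟨i, by simpa [hi] using hne⟩
  rw [Finset.mem_filter] at hr₀
  set s' := (s.filter fun r => v r ≠ 0).erase r₀ with hs'
  obtain ⟨r₁, hr₁, C, H⟩ := sum_upper (Φ := Φ) s' id (fun r => v r) r₀
    (fun r hr => hv r (by
      rw [hs', Finset.mem_erase, Finset.mem_filter] at hr
      exact hr.2.1)) (fun r hr => by
      rw [hs', Finset.mem_erase] at hr
      exact lt_of_le_of_ne (hmax r hr.2) hr.1)
  have hz : v r₀ + ∑ r ∈ s', v r = 0 := by
    rw [hs', Finset.add_sum_erase _ (fun r => v r) (Finset.mem_filter.2 hr₀),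
      Finset.sum_filter_ne_zero]
    exact hsum
  obtain ⟨c, hc, hev⟩ := sum_lower h (hv r₀ hr₀.1) hr₀.2 hr₁ H one_pos
  obtain ⟨t, ht⟩ := hev.exists
  rw [hz, map_zero, norm_zero] at ht
  have : 0 < c * Real.exp ((r₀ - 1) * t) := by positivity
  linarith

end

section
variable {d : ℕ}

/-- The flow as a family of linear maps. -/
def flowL (A : Matrix (Fin d) (Fin d) ℝ) (t : ℝ) : Euc d →ₗ[ℝ] Euc d :=
  Matrix.toEuclideanLin (NormedSpace.exp (t • A))

lemma linFlow_eq (A : Matrix (Fin d) (Fin d) ℝ) (t : ℝ) (x : Euc d) :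
    linFlow A t x = flowL A t x := rfl

lemma flowL_apply (A : Matrix (Fin d) (Fin d) ℝ) (t : ℝ) (x : Euc d) :
    flowL A t x = WithLp.toLp 2 (Matrix.mulVec (NormedSpace.exp (t • A)) (WithLp.ofLp x)) := rfl

lemma lin_bound {E F : Type*} [NormedAddCommGroup E] [NormedSpace ℝ E] [FiniteDimensional ℝ E]
    [NormedAddCommGroup F] [NormedSpace ℝ F] (L : E →ₗ[ℝ] F) :
    ∃ K ≥ (0 : ℝ), ∀ x, ‖L x‖ ≤ K * ‖x‖ :=
  ⟨‖LinearMap.toContinuousLinearMap L‖, norm_nonneg _,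
    fun x => (LinearMap.toContinuousLinearMap L).le_opNorm x⟩

open scoped Matrix.Norms.Operator in
lemma exp_sub_one_bound (A : Matrix (Fin d) (Fin d) ℝ)
    (F : Matrix (Fin d) (Fin d) ℝ →ₗ[ℝ] (Euc d →L[ℝ] Euc d)) :
    ∃ T > (0 : ℝ), ∃ L ≥ (0 : ℝ), ∀ t : ℝ, |t| ≤ T →
      ‖F (NormedSpace.exp (t • A) - 1)‖ ≤ L * |t| := by
  have h1 := (hasDerivAt_exp_smul_const (𝕂 := ℝ) A (0 : ℝ)).isBigO_sub
  obtain ⟨c, hc⟩ := h1.bound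
  rw [Metric.eventually_nhds_iff] at hc
  obtain ⟨T, hT, H⟩ := hc
  obtain ⟨K, hK, hG⟩ := lin_bound F
  refine ⟨T / 2, by positivity, K * |c|, by positivity, fun t ht => ?_⟩
  have h2 := H (y := t) (by rw [Real.dist_eq, sub_zero]; linarith)
  simp only [zero_smul, NormedSpace.exp_zero, sub_zero, Real.norm_eq_abs] at h2
  calc ‖F (NormedSpace.exp (t • A) - 1)‖
      ≤ K * ‖NormedSpace.exp (t • A) - 1‖ := hG _
    _ ≤ K * (|c| * |t|) := by
      gcongr
      exact h2.trans (by gcongr; exact le_abs_self c)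
    _ = _ := by ring

lemma flowL_lflow (A : Matrix (Fin d) (Fin d) ℝ) : LFlow (flowL A) where
  zero x := by simp [flowL_apply]
  add s t x := by
    rw [flowL_apply, flowL_apply, flowL_apply, add_smul, Matrix.exp_add_of_commute, Matrix.mulVec_mulVec]
    exact ((Commute.refl A).smul_left s).smul_right t
  lip := by
    let F : Matrix (Fin d) (Fin d) ℝ →ₗ[ℝ] (Euc d →L[ℝ] Euc d) :=
      (LinearMap.toContinuousLinearMap (𝕜 := ℝ) (E := Euc d) (F' := Euc d)).toLinearMap ∘ₗ
        (Matrix.toEuclideanLin (𝕜 := ℝ) (m := Fin d) (n := Fin d)).toLinearMap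
    obtain ⟨T, hT, L, hL, H⟩ := exp_sub_one_bound A F
    refine ⟨T, hT, L, hL, fun t ht x => ?_⟩
    have : flowL A t x - x = F (NormedSpace.exp (t • A) - 1) x := by
      rw [map_sub]
      change _ = flowL A t x - Matrix.toEuclideanLin (1 : Matrix (Fin d) (Fin d) ℝ) x
      simp
    rw [this]
    exact ((F _).le_opNorm x).trans (by gcongr; exact H t ht)

/-- coordinatewise real part -/
def rePart (d : ℕ) : (Fin d → ℂ) →ₗ[ℝ] Euc d :=
  (WithLp.linearEquiv 2 ℝ (Fin d → ℝ)).symm.toLinearMap ∘ₗ (Complex.reLm.compLeft (Fin d))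

lemma rePart_apply (z : Fin d → ℂ) (i : Fin d) : rePart d z i = (z i).re := rfl

open scoped Matrix.Norms.Operator in
lemma exp_map_ofReal (A : Matrix (Fin d) (Fin d) ℝ) (t : ℝ) :
    (NormedSpace.exp (t • A)).map Complex.ofReal =
      NormedSpace.exp ((t : ℂ) • A.map Complex.ofReal) := by
  have h := NormedSpace.map_exp (Complex.ofRealHom.mapMatrix (m := Fin d))
    (by
      refine continuous_matrix fun i j => ?_
      exact Complex.continuous_ofReal.comp (continuous_id.matrix_elem i j)) (t • A)
  have h2 : Complex.ofRealHom.mapMatrix (t • A) = (t : ℂ) • A.map Complex.ofReal := by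
    ext i j; simp
  rw [h2] at h
  exact h

lemma flowL_rePart (A : Matrix (Fin d) (Fin d) ℝ) (t : ℝ) (z : Fin d → ℂ) :
    flowL A t (rePart d z) =
      rePart d (Matrix.mulVec (NormedSpace.exp ((t : ℂ) • A.map Complex.ofReal)) z) := by
  rw [← exp_map_ofReal]
  ext i
  rw [rePart_apply, flowL_apply]
  simp [Matrix.mulVec, dotProduct, rePart_apply]

open scoped Matrix.Norms.Operator in
lemma exp_mulVec_nil (N : Matrix (Fin d) (Fin d) ℂ) (z : Fin d → ℂ) (k : ℕ)
    (hk : Matrix.mulVec (N ^ k) z = 0) (t : ℂ) :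
    Matrix.mulVec (NormedSpace.exp (t • N)) z =
      ∑ n ∈ Finset.range k, ((n.factorial : ℂ)⁻¹ * t ^ n) • Matrix.mulVec (N ^ n) z := by
  have h := NormedSpace.exp_series_hasSum_exp' (𝕂 := ℂ) (t • N)
  let G : Matrix (Fin d) (Fin d) ℂ →ₗ[ℂ] (Fin d → ℂ) :=
    { toFun := fun P => Matrix.mulVec P z
      map_add' := fun P Q => Matrix.add_mulVec P Q z
      map_smul' := fun c P => Matrix.smul_mulVec c P z }
  have h2 := h.mapL (LinearMap.toContinuousLinearMap G)
  have h3 : ∀ n, LinearMap.toContinuousLinearMap G ((n.factorial : ℂ)⁻¹ • (t • N) ^ n) =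
      ((n.factorial : ℂ)⁻¹ * t ^ n) • Matrix.mulVec (N ^ n) z := by
    intro n
    rw [map_smul, smul_pow, map_smul, smul_smul]
    rfl
  simp only [h3] at h2
  have h4 := hasSum_sum_of_ne_finset_zero (L := SummationFilter.unconditional ℕ) (s := Finset.range k)
    (f := fun n => ((n.factorial : ℂ)⁻¹ * t ^ n) • Matrix.mulVec (N ^ n) z) (by
      intro n hn
      rw [Finset.mem_range, not_lt] at hn
      have : Matrix.mulVec (N ^ n) z = 0 := by
        rw [← Nat.sub_add_cancel hn, pow_add, ← Matrix.mulVec_mulVec, hk, Matrix.mulVec_zero]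
      simp only [this, smul_zero])
  exact h2.unique h4

lemma exp_mulVec_split (M : Matrix (Fin d) (Fin d) ℂ) (μ t : ℂ) :
    NormedSpace.exp (t • M) = Complex.exp (t * μ) • NormedSpace.exp (t • (M - μ • 1)) := by
  have h1 : t • M = (t * μ) • 1 + t • (M - μ • 1) := by
    rw [smul_sub, smul_smul]; abel
  rw [h1, Matrix.exp_add_of_commute _ _ ((Commute.one_left _).smul_left _)]
  have h2 : (t * μ) • (1 : Matrix (Fin d) (Fin d) ℂ) = Matrix.diagonal (fun _ => t * μ) := by
    rw [← Matrix.diagonal_one, ← Matrix.diagonal_smul]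
    congr 1; ext; simp
  have h3 : NormedSpace.exp (fun _ : Fin d => t * μ) = fun _ => Complex.exp (t * μ) := by
    rw [Pi.exp_def]
    funext i
    rw [Complex.exp_eq_exp_ℂ]
  rw [h2, Matrix.exp_diagonal, h3]
  ext i j
  simp [Matrix.diagonal_mul]

lemma grow_genEigen (A : Matrix (Fin d) (Fin d) ℝ) (μ : ℂ) (z : Fin d → ℂ) (k : ℕ)
    (hk : Matrix.mulVec ((A.map Complex.ofReal - μ • 1) ^ k) z = 0) :
    rePart d z ∈ growSp (flowL A) μ.re := by
  intro ε hε
  let R := LinearMap.toContinuousLinearMap (rePart d)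
  set N := A.map Complex.ofReal - μ • 1 with hN
  refine ⟨‖R‖ * ∑ n ∈ Finset.range k, (ε ^ n)⁻¹ * ‖Matrix.mulVec (N ^ n) z‖, by positivity, fun t => ?_⟩
  rw [flowL_rePart, exp_mulVec_split _ μ, ← hN, Matrix.smul_mulVec, exp_mulVec_nil N z k hk]
  change ‖R _‖ ≤ _
  refine (R.le_opNorm _).trans ?_
  rw [mul_assoc]
  apply mul_le_mul_of_nonneg_left _ (norm_nonneg _)
  have e1 : ‖Complex.exp ((t : ℂ) * μ)‖ = Real.exp (μ.re * t) := by
    rw [Complex.norm_exp]; simp [mul_comm]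
  rw [norm_smul, e1, Real.exp_add, mul_comm (Finset.sum _ _), mul_assoc]
  apply mul_le_mul_of_nonneg_left _ (Real.exp_pos _).le
  rw [Finset.mul_sum]
  refine (norm_sum_le _ _).trans (Finset.sum_le_sum fun n _ => ?_)
  rw [norm_smul, ← mul_assoc]
  apply mul_le_mul_of_nonneg_right _ (norm_nonneg _)
  have h1 := Real.pow_div_factorial_le_exp (ε * |t|) (by positivity) n
  rw [norm_mul, norm_inv, norm_pow, Complex.norm_real, Complex.norm_natCast, Real.norm_eq_abs]
  rw [mul_pow] at h1
  have : ((n.factorial : ℝ)⁻¹ * |t| ^ n) = (ε ^ n * |t| ^ n / n.factorial) * (ε ^ n)⁻¹ := by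
    field_simp
  rw [this]
  gcongr

lemma iSup_growSp (A : Matrix (Fin d) (Fin d) ℝ) : ⨆ r, growSp (flowL A) r = ⊤ := by
  rw [eq_top_iff]
  rintro x -
  have key : ∀ z : Fin d → ℂ, rePart d z ∈ ⨆ r, growSp (flowL A) r := by
    intro z
    have hz : z ∈ ⨆ μ, Module.End.maxGenEigenspace (Matrix.toLin' (A.map Complex.ofReal)) μ := by
      rw [Module.End.iSup_maxGenEigenspace_eq_top]; trivial
    induction hz using Submodule.iSup_induction' with
    | mem μ z hz =>
      rw [Module.End.mem_maxGenEigenspace] at hz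
      obtain ⟨k, hk⟩ := hz
      refine Submodule.mem_iSup_of_mem μ.re (grow_genEigen A μ z k ?_)
      have : Matrix.toLin' ((A.map Complex.ofReal - μ • 1) ^ k) =
          (Matrix.toLin' (A.map Complex.ofReal) - μ • 1) ^ k := by
        rw [Matrix.toLin'_pow, map_sub, map_smul, Matrix.toLin'_one]; rfl
      rw [← this, Matrix.toLin'_apply] at hk
      exact hk
    | zero => rw [map_zero]; exact Submodule.zero_mem _
    | add x y _ _ hx hy => rw [map_add]; exact Submodule.add_mem _ hx hy
  have : x = rePart d (fun i => (x i : ℂ)) := by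
    ext i; simp [rePart_apply]
  rw [this]
  exact key _

end

section
variable {E : Type*} [NormedAddCommGroup E] [NormedSpace ℝ E] [FiniteDimensional ℝ E]
  {Φ : ℝ → E →ₗ[ℝ] E}

lemma growSp_internal (h : LFlow Φ) (hs : ⨆ r, growSp Φ r = ⊤)
    [DecidableEq {r // growSp Φ r ≠ ⊥}] :
    DirectSum.IsInternal (fun i : {r // growSp Φ r ≠ ⊥} => growSp Φ i) := by
  classical
  refine DirectSum.isInternal_submodule_of_iSupIndep_of_iSup_eq_top
    ((growSp_indep h).comp Subtype.val_injective) ?_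
  rw [eq_top_iff, ← hs]
  refine iSup_le fun r => ?_
  by_cases hr : growSp Φ r = ⊥
  · rw [hr]; exact bot_le
  · exact le_iSup (fun i : {r // growSp Φ r ≠ ⊥} => growSp Φ i) ⟨r, hr⟩

lemma growSp_finite (h : LFlow Φ) : Finite {r // growSp Φ r ≠ ⊥} :=
  WellFoundedGT.finite_ne_bot_of_iSupIndep (growSp_indep h)

lemma exists_basis (h : LFlow Φ) (hs : ⨆ r, growSp Φ r = ⊤) {d : ℕ} (hd : Module.finrank ℝ E = d) :
    ∃ (b : Module.Basis (Fin d) ℝ E) (r : Fin d → ℝ), Monotone r ∧ (∀ j, b j ∈ growSp Φ (r j)) ∧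
      ∀ s, ∀ v ∈ growSp Φ s, ∀ j, r j ≠ s → b.repr v j = 0 := by
  classical
  have := growSp_finite h
  have : Fintype {r // growSp Φ r ≠ ⊥} := Fintype.ofFinite _
  have hi := growSp_internal h hs
  let b0 := hi.collectedBasis (fun i => Module.finBasis ℝ (growSp Φ i))
  have hcard := Module.finrank_eq_card_basis b0
  rw [hd] at hcard
  let e := Fintype.equivFinOfCardEq hcard.symm
  let σ := Tuple.sort (fun j => ((e.symm j).1 : ℝ))
  refine ⟨b0.reindex (e.trans σ.symm), fun j => (e.symm (σ j)).1, Tuple.monotone_sort (fun j => ((e.symm j).1 : ℝ)), ?_, ?_⟩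
  · intro j
    rw [Module.Basis.reindex_apply]
    exact hi.collectedBasis_mem _ _
  · intro s v hv j hj
    rw [Module.Basis.repr_reindex_apply]
    by_cases hb : growSp Φ s = ⊥
    · rw [hb, Submodule.mem_bot] at hv
      simp [hv]
    · exact hi.collectedBasis_repr_of_mem_ne (fun i => Module.finBasis ℝ (growSp Φ i)) (x := v) (i := ⟨s, hb⟩)
        (j := (e.symm (σ j)).1) (fun hh => hj (congrArg Subtype.val hh).symm) (a := (e.symm (σ j)).2) hv

lemma normal_form (h : LFlow Φ) (hs : ⨆ r, growSp Φ r = ⊤) {d : ℕ}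
    (b : Module.Basis (Fin d) ℝ E) (r : Fin d → ℝ)
    (hb0 : ∀ s, ∀ v ∈ growSp Φ s, ∀ j, r j ≠ s → b.repr v j = 0) (hr : ∀ j, r j ≠ 0) :
    ∃ H : E ≃ₜ (Fin d → ℝ), HH 1 H ∧ ∀ t x j, H (Φ t x) j = Real.exp (r j * t) * H x j := by
  classical
  have := growSp_finite h
  have : Fintype {r // growSp Φ r ≠ ⊥} := Fintype.ofFinite _
  have hi := growSp_internal h hs
  let V : {r // growSp Φ r ≠ ⊥} → Submodule ℝ E := fun i => growSp Φ i
  let T0 : (∀ i, V i) ≃ₗ[ℝ] E := (DirectSum.linearEquivFunOnFintype ℝ _ (fun i => V i)).symm.trans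
    (LinearEquiv.ofBijective (DirectSum.coeLinearMap V) hi)
  have hT0 : ∀ v : (∀ i, V i), T0 v = ∑ i, (v i : E) := by
    intro v
    have : v = ∑ i, Pi.single i (v i) := (Finset.univ_sum_single v).symm
    conv_lhs => rw [this]
    rw [map_sum]
    refine Finset.sum_congr rfl fun i _ => ?_
    have e1 : T0 (Pi.single i (v i)) =
        DirectSum.coeLinearMap V ((DirectSum.linearEquivFunOnFintype ℝ _ (fun i => V i)).symm
          (Pi.single i (v i))) := rfl
    rw [e1, DirectSum.linearEquivFunOnFintype_symm_single, DirectSum.coeLinearMap_lof]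
  have hi0 : ∀ i : {r // growSp Φ r ≠ ⊥}, (i : ℝ) ≠ 0 := by
    intro i hi0
    apply i.2
    rw [Submodule.eq_bot_iff]
    intro v hv
    apply b.repr.injective
    ext j
    rw [hb0 i v hv j (by rw [hi0]; exact hr j)]
    simp
  choose K hK1 hK2 using fun i : {r // growSp Φ r ≠ ⊥} =>
    block_all (resFlow_lflow h i) (hi0 i) (resFlow_gr h i)
  let T := T0.toContinuousLinearEquiv
  let B := b.equivFun.toContinuousLinearEquiv
  let P : (∀ i, V i) ≃ₜ (∀ i, V i) := Homeomorph.piCongrRight K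
  have hP : HH 1 P := HH.pi hK1
  have hTT := HH.cle T
  have hBB := HH.cle B
  let H := (T.toHomeomorph.symm.trans P).trans (T.toHomeomorph.trans B.toHomeomorph)
  have h1 := (hTT.symm.trans one_pos one_pos hP).trans (by norm_num) (by norm_num)
    (hTT.trans one_pos one_pos hBB)
  norm_num at h1
  refine ⟨H, h1, ?_⟩
  have hcoord : ∀ v : (∀ i, V i), ∀ t, ∀ j,
      b.repr (∑ i, ((Real.exp (i * t) • v i : V i) : E)) j = Real.exp (r j * t) * b.repr (∑ i, (v i : E)) j := by
    intro v t j
    simp only [map_sum, Finsupp.coe_finsetSum, Finset.sum_apply, Finset.mul_sum]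
    refine Finset.sum_congr rfl fun i _ => ?_
    rw [Submodule.coe_smul, map_smul, Finsupp.smul_apply, smul_eq_mul]
    by_cases hij : r j = i
    · rw [hij]
    · rw [hb0 i _ (v i).2 j hij]; simp
  intro t x j
  obtain ⟨v, rfl⟩ := T0.surjective x
  have e1 : Φ t (T0 v) = T0 (fun i => resFlow h i t (v i)) := by
    rw [hT0, hT0, map_sum]
    rfl
  have e2 : ∀ w : (∀ i, V i), H (T0 w) = b.equivFun (T0 (fun i => K i (w i))) := by
    intro w
    change b.equivFun (T0 (fun i => K i (T0.symm (T0 w) i))) = _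
    rw [T0.symm_apply_apply]
  rw [e1, e2, e2]
  simp only [hK2]
  rw [hT0, hT0]
  exact hcoord (fun i => K i (v i)) t j

end

section
variable {d : ℕ} (A : Matrix (Fin d) (Fin d) ℝ)

lemma lyap_eq (b : Module.Basis (Fin d) ℝ (Euc d)) (r : Fin d → ℝ)
    (hb : ∀ j, b j ∈ growSp (flowL A) (r j)) {x : Euc d} (hx : x ≠ 0) :
    ∃ j, b.repr x j ≠ 0 ∧ (∀ k, b.repr x k ≠ 0 → r k ≤ r j) ∧ lyap A x = r j := by
  classical
  have hne : ∃ j, b.repr x j ≠ 0 := by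
    by_contra hcon
    push Not at hcon
    apply hx
    apply b.repr.injective
    ext j
    rw [hcon j]; simp
  obtain ⟨j₀, hj₀⟩ := hne
  obtain ⟨j, hj, hmax⟩ := Finset.exists_max_image (Finset.univ.filter fun j => b.repr x j ≠ 0) r
    ⟨j₀, by simpa using hj₀⟩
  simp only [Finset.mem_filter, Finset.mem_univ, true_and] at hj hmax
  refine ⟨j, hj, hmax, ?_⟩
  set y := ∑ k ∈ Finset.univ.filter (fun k => r j ≤ r k), b.repr x k • b k with hy
  set w := ∑ k ∈ Finset.univ.filter (fun k => ¬ r j ≤ r k), b.repr x k • b k with hw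
  have hyw : y + w = x := by
    rw [hy, hw, Finset.sum_filter_add_sum_filter_not]
    exact b.sum_repr x
  have hyg : y ∈ growSp (flowL A) (r j) := by
    refine Submodule.sum_mem _ fun k hk => ?_
    by_cases hk0 : b.repr x k = 0
    · rw [hk0, zero_smul]; exact Submodule.zero_mem _
    · have : r k = r j := le_antisymm (hmax k hk0) (Finset.mem_filter.1 hk).2
      rw [← this]
      exact Submodule.smul_mem _ _ (hb k)
  have hy0 : y ≠ 0 := by
    intro h0
    have h1 : b.repr y j = b.repr x j := by
      rw [hy]
      simp only [map_sum, map_smul, Module.Basis.repr_self, Finsupp.coe_finsetSum, Finset.sum_apply,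
        Finsupp.smul_apply, smul_eq_mul, Finsupp.single_apply, mul_ite, mul_one, mul_zero]
      rw [Finset.sum_ite_eq']
      simp
    rw [h0] at h1
    apply hj
    rw [← h1]; simp
  obtain ⟨r₁, hr₁, C, H⟩ := sum_upper (Φ := flowL A) (Finset.univ.filter (fun k => ¬ r j ≤ r k)) r
    (fun k => b.repr x k • b k) (r j) (fun k _ => Submodule.smul_mem _ _ (hb k))
    (fun k hk => not_le.1 (Finset.mem_filter.1 hk).2)
  have ht := sum_lyap (flowL_lflow A) hyg hy0 hr₁ H
  rw [← hw, hyw] at ht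
  exact ht.limsup_eq

lemma span_lyapSet (b : Module.Basis (Fin d) ℝ (Euc d)) (r : Fin d → ℝ)
    (hb : ∀ j, b j ∈ growSp (flowL A) (r j)) (s : ℝ) :
    Submodule.span ℝ (lyapSet A s) =
      Submodule.span ℝ (Set.range fun j : {j // r j ≤ s} => b j) := by
  apply le_antisymm
  · rw [Submodule.span_le]
    intro x hx
    by_cases hx0 : x = 0
    · rw [hx0]; exact Submodule.zero_mem _
    obtain ⟨j, hj, hmax, hl⟩ := lyap_eq A b r hb hx0
    have hls : r j ≤ s := by
      rw [← hl]; exact hx.resolve_left hx0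
    rw [← b.sum_repr x]
    refine Submodule.sum_mem _ fun k _ => ?_
    by_cases hk0 : b.repr x k = 0
    · rw [hk0, zero_smul]; exact Submodule.zero_mem _
    · exact Submodule.smul_mem _ _ (Submodule.subset_span ⟨⟨k, (hmax k hk0).trans hls⟩, rfl⟩)
  · rw [Submodule.span_le]
    rintro _ ⟨⟨j, hj⟩, rfl⟩
    refine Submodule.subset_span (Or.inr ?_)
    obtain ⟨k, hk, -, hl⟩ := lyap_eq A b r hb (b.ne_zero j)
    rw [Module.Basis.repr_self, Finsupp.single_apply] at hk
    have : j = k := by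
      by_contra hcon
      simp [hcon] at hk
    change lyap A (b j) ≤ s
    rw [hl, ← this]
    exact hj

lemma lyapExp_eq (b : Module.Basis (Fin d) ℝ (Euc d)) (r : Fin d → ℝ) (hm : Monotone r)
    (hb : ∀ j, b j ∈ growSp (flowL A) (r j)) (j : Fin d) : lyapExp A j = r j := by
  classical
  have hell : ∀ s, ell A s = (Finset.univ.filter fun k => r k ≤ s).card := by
    intro s
    rw [ell, span_lyapSet A b r hb s, finrank_span_eq_card, Fintype.card_subtype]
    exact b.linearIndependent.comp _ Subtype.val_injective
  have : {s : ℝ | (j : ℕ) + 1 ≤ ell A s} = Set.Ici (r j) := by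
    ext s
    rw [Set.mem_ofPred_eq, hell, Set.mem_Ici]
    constructor
    · intro hc
      by_contra hcon
      push Not at hcon
      have : (Finset.univ.filter fun k => r k ≤ s) ⊆ Finset.Iio j := by
        intro k hk
        rw [Finset.mem_Iio]
        by_contra hkj
        push Not at hkj
        have := hm hkj
        have := (Finset.mem_filter.1 hk).2
        linarith
      have := Finset.card_le_card this
      rw [Fin.card_Iio] at this
      omega
    · intro hc
      have : Finset.Iic j ⊆ (Finset.univ.filter fun k => r k ≤ s) := by
        intro k hk
        rw [Finset.mem_Iic] at hk
        exact Finset.mem_filter.2 ⟨Finset.mem_univ _, (hm hk).trans hc⟩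
      have := Finset.card_le_card this
      rwa [Fin.card_Iic] at this
  rw [lyapExp, this, csInf_Ici]

lemma normal_form_matrix (hA : ∀ j : Fin d, lyapExp A j ≠ 0) :
    ∃ H : Euc d ≃ₜ (Fin d → ℝ), HH 1 H ∧
      ∀ t x j, H (linFlow A t x) j = Real.exp (lyapExp A j * t) * H x j := by
  obtain ⟨b, r, hm, hb, hb0⟩ := exists_basis (flowL_lflow A) (iSup_growSp A) (d := d) (by simp)
  have hl := lyapExp_eq A b r hm hb
  obtain ⟨H, h1, h2⟩ := normal_form (flowL_lflow A) (iSup_growSp A) b r hb0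
    (fun j => by rw [← hl j]; exact hA j)
  refine ⟨H, h1, fun t x j => ?_⟩
  rw [hl j]
  exact h2 t x j

end

section
variable {d : ℕ}

lemma HH.memHBelow {β : ℝ} {h : Euc d ≃ₜ Euc d} (H : HH β h) : MemHBelow β h := by
  have key : ∀ f : Euc d → Euc d, Hol β f → ∀ γ : ℝ, 0 < γ → γ < β → HolderNearZero γ f := by
    intro f hf γ h0 h1
    obtain ⟨r, hr, K, hK, hh⟩ := hf γ h0 h1
    refine ⟨r, hr, K, fun x hx y hy => ?_⟩
    rw [dist_eq_norm, dist_eq_norm]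
    exact hh x y (mem_ball_zero_iff.1 hx) (mem_ball_zero_iff.1 hy)
  exact fun γ h0 h1 => ⟨H.1, key _ H.2.1 γ h0 h1, key _ H.2.2 γ h0 h1⟩

lemma simEquiv_of_rhoPlus (hd : 0 < d) (A B : Matrix (Fin d) (Fin d) ℝ)
    (β : ℝ) (hβ0 : 0 < β) (hβ1 : β < 1) (hρ : β ^ 2 ≤ rhoPlus A B) :
    SimEquivWith (MemHBelow β) A B := by
  have : Nonempty (Fin d) := ⟨⟨0, hd⟩⟩
  let q : Fin d → ℝ := fun j => lyapExp A j / lyapExp B j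
  obtain ⟨m, hm⟩ : ∃ m, m = ⨅ j, q j := ⟨_, rfl⟩
  obtain ⟨M, hM⟩ : ∃ M, M = ⨆ j, q j := ⟨_, rfl⟩
  have hmq : ∀ j, m ≤ q j := fun j => hm ▸ ciInf_le (Set.finite_range q).bddBelow j
  have hqM : ∀ j, q j ≤ M := fun j => hM ▸ le_ciSup (Set.finite_range q).bddAbove j
  have hρ' : β ^ 2 ≤ m / |M| := by rw [hm, hM]; exact hρ
  have hβ2 : 0 < β ^ 2 := by positivity
  have hm0 : 0 < m := by
    by_contra hcon
    push Not at hcon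
    have := div_nonpos_of_nonpos_of_nonneg hcon (abs_nonneg M)
    linarith
  have hM0 : 0 < M := hm0.trans_le ((hmq ⟨0, hd⟩).trans (hqM ⟨0, hd⟩))
  rw [abs_of_pos hM0, le_div_iff₀ hM0] at hρ'
  obtain ⟨α, hα⟩ : ∃ α, α = Real.sqrt (m * M) := ⟨_, rfl⟩
  have hα0 : 0 < α := by rw [hα]; positivity
  have hαs : α ^ 2 = m * M := by rw [hα]; exact Real.sq_sqrt (by positivity)
  have i1 : β * M ≤ α := by
    apply le_of_sq_le_sq _ hα0.le
    rw [hαs]; nlinarith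
  have i2 : β * α ≤ m := by
    apply le_of_sq_le_sq _ hm0.le
    rw [mul_pow, hαs]; nlinarith
  have hq0 : ∀ j, 0 < q j := fun j => hm0.trans_le (hmq j)
  have ha : ∀ j : Fin d, lyapExp A j ≠ 0 := by
    intro j h0
    have := hq0 j
    simp [q, h0] at this
  have hb : ∀ j : Fin d, lyapExp B j ≠ 0 := by
    intro j h0
    have := hq0 j
    simp [q, h0] at this
  obtain ⟨HA, hA1, hA2⟩ := normal_form_matrix A ha
  obtain ⟨HB, hB1, hB2⟩ := normal_form_matrix B hb
  have hp : ∀ j : Fin d, α * lyapExp B j / lyapExp A j = α / q j := by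
    intro j
    have := ha j
    have := hb j
    simp only [q]
    field_simp
  have hp' : ∀ j : Fin d, lyapExp A j / (α * lyapExp B j) = q j / α := by
    intro j
    have := ha j
    have := hb j
    simp only [q]
    field_simp
  choose K hK1 hK2 using fun j : Fin d => scalar_block (a := lyapExp A j) (b := α * lyapExp B j)
    (β := β) (by rw [hp]; exact div_pos hα0 (hq0 j)) hβ1.le
    (by
      rw [hp, le_div_iff₀ (hq0 j)]
      exact (mul_le_mul_of_nonneg_left (hqM j) hβ0.le).trans i1)
    (by
      rw [hp', le_div_iff₀ hα0]
      exact i2.trans (hmq j))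
  have hP : HH β (Homeomorph.piCongrRight K) := HH.pi hK1
  have hh := (hA1.trans one_pos hβ0 hP).trans (by positivity) one_pos hB1.symm
  rw [one_mul, mul_one] at hh
  refine ⟨_, α, hα0.ne', hh.memHBelow, fun t x => ?_⟩
  apply HB.injective
  funext j
  rw [hB2]
  simp only [Homeomorph.trans_apply, Homeomorph.apply_symm_apply]
  change K j (HA (linFlow A t x) j) = _ * K j (HA x j)
  rw [hA2, hK2]
  congr 2
  ring

lemma linFlow_neg (A : Matrix (Fin d) (Fin d) ℝ) (t : ℝ) (x : Euc d) :
    linFlow A t x = linFlow (-A) (-t) x := by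
  rw [linFlow, linFlow, neg_smul_neg]

end

/-- **Corollary 4.10**: for hyperbolic flows `Φ`, `Ψ` and `0 < β < 1`, if
`β² ≤ ρ(Φ,Ψ)` then `Φ ≃^{β⁻} Ψ`. -/
theorem hyperbolic_crossratio_simEquiv {d : ℕ} (hd : 0 < d)
    (A B : Matrix (Fin d) (Fin d) ℝ)
    (hA : IsHyperbolic A) (hB : IsHyperbolic B)
    (β : ℝ) (hβ0 : 0 < β) (hβ1 : β < 1) (hρ : β ^ 2 ≤ rho A B) :
    SimEquivWith (MemHBelow β) A B := by
  rcases le_max_iff.1 hρ with h | h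
  · exact simEquiv_of_rhoPlus hd A B β hβ0 hβ1 h
  · obtain ⟨g, α, hα, hg, hc⟩ := simEquiv_of_rhoPlus hd (-A) B β hβ0 hβ1 h
    refine ⟨g, -α, neg_ne_zero.2 hα, hg, fun t x => ?_⟩
    rw [linFlow_neg, hc]
    congr 1
    ring


end LF
end
end

section
/- Let m_0, n_0 ∈ ℕ_0 and m, n ∈ ℕ with m_0 + 2m = n_0 + 2n = d, and let b ∈ (ℝ⁺)^m, c ∈ (ℝ⁺)^n. Let Φ, Ψ be the linear flows on ℝ^d generated by diag[O_{m_0}, J_1(ib_1), …, J_1(ib_m)] and diag[O_{n_0}, J_1(ic_1), …, J_1(ic_n)] respectively (the zero block O_{m_0}, resp. O_{n_0}, present only if m_0 ≥ 1, resp. n_0 ≥ 1). Then the following are equivalent: (i) there exists an open set U ⊂ ℝ^d with 0 ∈ U and a continuous one-to-one function f : U → ℝ^d with T_x^Φ = T_{f(x)}^Ψ for every x ∈ U; (ii) (m_0, m) = (n_0, n), and there exists a permutation p of {1,…,m} with b_j = c_{p(j)} for every j ∈ {1,…,m}; (iii) Φ and Ψ are linearly conjugate, i.e. there is an invertible linear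 map h on ℝ^d with h Φ_t = Ψ_t h for all t ∈ ℝ. -/
noncomputable section
namespace LF

open Filter Topology

variable {d : ℕ}

def rotEquiv (m0 m d : ℕ) (h : m0 + 2 * m = d) : (Fin m0 ⊕ (Fin 2 × Fin m)) ≃ Fin d :=
  ((Equiv.refl (Fin m0)).sumCongr finProdFinEquiv).trans (finSumFinEquiv.trans (finCongr h))

/-- The matrix `diag [O_{m0}, J_1(i b_1), …, J_1(i b_m)]` of size `d = m0 + 2m`. -/
def rotBlockMat (m0 m d : ℕ) (h : m0 + 2 * m = d) (b : Fin m → ℝ) :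
    Matrix (Fin d) (Fin d) ℝ :=
  Matrix.reindex (rotEquiv m0 m d h) (rotEquiv m0 m d h)
    (Matrix.fromBlocks 0 0 0 (Matrix.blockDiagonal fun j : Fin m => !![0, -(b j); b j, 0]))

section Brouwer
variable {E : Type*} [NormedAddCommGroup E] [InnerProductSpace ℝ E] [FiniteDimensional ℝ E]

lemma aux_det_poly (M : E →L[ℝ] E) : ∃ q : Polynomial ℝ, q.natDegree ≤ Module.finrank ℝ E ∧
    ∀ t : ℝ, q.eval t = (ContinuousLinearMap.id ℝ E + t • (M - ContinuousLinearMap.id ℝ E)).det := by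
  classical
  let b := Module.finBasis ℝ E
  let A : Matrix (Fin (Module.finrank ℝ E)) (Fin (Module.finrank ℝ E)) ℝ := LinearMap.toMatrix b b ((M - ContinuousLinearMap.id ℝ E : E →L[ℝ] E) : E →ₗ[ℝ] E)
  refine ⟨((Polynomial.X : Polynomial ℝ) • A.map Polynomial.C + (1 : Matrix (Fin (Module.finrank ℝ E)) (Fin (Module.finrank ℝ E)) ℝ).map Polynomial.C).det, ?_, ?_⟩
  · simpa using Polynomial.natDegree_det_X_add_C_le A 1
  · intro t
    rw [← Polynomial.coe_evalRingHom, RingHom.map_det, ContinuousLinearMap.det, ← LinearMap.det_toMatrix b]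
    congr 1
    have : LinearMap.toMatrix b b ((ContinuousLinearMap.id ℝ E + t • (M - ContinuousLinearMap.id ℝ E) : E →L[ℝ] E) : E →ₗ[ℝ] E) = 1 + t • A := by
      rw [ContinuousLinearMap.toLinearMap_add, ContinuousLinearMap.toLinearMap_smul, map_add, map_smul]
      congr 1
      exact LinearMap.toMatrix_id b
    rw [this]
    ext i j
    simp [Matrix.one_apply, add_comm, apply_ite]
    exact mul_comm _ _

lemma aux_lagrange (n : ℕ) (t : Fin (n+1) → ℝ) (ht : Function.Injective t) (q : Polynomial ℝ)
    (hq : q.natDegree ≤ n) :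
    q.eval 1 = ∑ i, q.eval (t i) * (Lagrange.basis Finset.univ t i).eval 1 := by
  have h := Lagrange.eq_interpolate (s := Finset.univ) (v := t) (f := q) ht.injOn (by
    rw [Finset.card_univ, Fintype.card_fin]
    exact (Polynomial.degree_le_of_natDegree_le hq).trans_lt (by exact_mod_cast Nat.lt_succ_self n))
  conv_lhs => rw [h]
  rw [Lagrange.interpolate_apply, Polynomial.eval_finsetSum]
  simp

lemma aux_perturb_bij (g : E → E) (K : NNReal) (hg : LipschitzWith K g) (t : ℝ) (ht0 : 0 ≤ t)
    (ht : t * K < 1) : Function.Bijective (fun x => x + t • g x) := by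
  have hA : ApproximatesLinearOn (fun x => x + t • g x)
      ((ContinuousLinearEquiv.refl ℝ E : E ≃L[ℝ] E) : E →L[ℝ] E) Set.univ (Real.toNNReal t * K) := by
    intro x _ y _
    have := hg.dist_le_mul x y
    rw [dist_eq_norm, dist_eq_norm] at this
    have e : x + t • g x - (y + t • g y) - ((ContinuousLinearEquiv.refl ℝ E : E ≃L[ℝ] E) : E →L[ℝ] E) (x - y) = t • (g x - g y) := by
      simp [smul_sub]; abel
    rw [e, norm_smul, Real.norm_of_nonneg ht0, NNReal.coe_mul, Real.coe_toNNReal t ht0, mul_assoc]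
    exact mul_le_mul_of_nonneg_left this ht0
  have hc : Subsingleton E ∨ (Real.toNNReal t * K : NNReal) < ‖(((ContinuousLinearEquiv.refl ℝ E).symm : E ≃L[ℝ] E) : E →L[ℝ] E)‖₊⁻¹ := by
    rcases subsingleton_or_nontrivial E with h | h
    · exact Or.inl h
    · right
      have : ‖(((ContinuousLinearEquiv.refl ℝ E).symm : E ≃L[ℝ] E) : E →L[ℝ] E)‖₊ = 1 := by
        ext
        exact ContinuousLinearMap.norm_id
      rw [this, inv_one, ← NNReal.coe_lt_coe, NNReal.coe_mul, Real.coe_toNNReal t ht0]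
      exact ht
  exact ⟨Set.injOn_univ.1 (hA.injOn hc), hA.surjective hc⟩

lemma no_retraction (r : E → E) (hr : ∀ x ∈ Metric.closedBall (0 : E) 1, ContDiffAt ℝ 1 r x)
    (hr1 : ∀ x ∈ Metric.closedBall (0 : E) 1, ‖r x‖ = 1)
    (hrs : ∀ x, ‖x‖ = 1 → r x = x) : False := by
  classical
  let _ : MeasurableSpace E := borel E
  have _ : BorelSpace E := ⟨rfl⟩
  let B := Metric.closedBall (0 : E) 1
  have hBc : IsCompact B := isCompact_closedBall 0 1
  have hD : ∀ x ∈ B, ContinuousAt (fderiv ℝ r) x := fun x hx =>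
    ((hr x hx).fderiv_right (m := 0) (by simp)).continuousAt
  have hdiff : ∀ x ∈ B, DifferentiableAt ℝ r x := fun x hx => (hr x hx).differentiableAt (by simp)
  -- Lipschitz
  let g : E → E := fun x => if ‖x‖ ≤ 1 then r x - x else 0
  obtain ⟨C, hC⟩ : ∃ C : ℝ, ∀ x ∈ B, ‖fderiv ℝ r x‖ ≤ C := by
    obtain ⟨C, hC⟩ := hBc.exists_bound_of_continuousOn (f := fderiv ℝ r)
      (fun x hx => (hD x hx).continuousWithinAt)
    exact ⟨C, hC⟩
  have hC0 : 0 ≤ C := (norm_nonneg _).trans (hC 0 (by simp [B]))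
  have hLr : LipschitzOnWith ⟨C, hC0⟩ r B :=
    Convex.lipschitzOnWith_of_nnnorm_fderiv_le (𝕜 := ℝ) hdiff (fun x hx => hC x hx) (convex_closedBall 0 1)
  have key : ∀ x ∈ B, ∀ y ∈ B, ‖g x - g y‖ ≤ (C + 1) * ‖x - y‖ := by
    intro x hx y hy
    have h1 := hLr.dist_le_mul x hx y hy
    rw [dist_eq_norm, dist_eq_norm] at h1
    have hx' : ‖x‖ ≤ 1 := by simpa [B] using hx
    have hy' : ‖y‖ ≤ 1 := by simpa [B] using hy
    simp only [g, hx', hy', if_true]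
    calc ‖r x - x - (r y - y)‖ = ‖(r x - r y) - (x - y)‖ := by congr 1; abel
      _ ≤ ‖r x - r y‖ + ‖x - y‖ := norm_sub_le _ _
      _ ≤ C * ‖x - y‖ + ‖x - y‖ := by gcongr; exact h1
      _ = _ := by ring
  have gout : ∀ x, 1 ≤ ‖x‖ → g x = 0 := by
    intro x hx
    simp only [g]
    split_ifs with h
    · rw [hrs x (le_antisymm h hx), sub_self]
    · rfl
  have key2 : ∀ x ∈ B, ∀ y, y ∉ B → ‖g x - g y‖ ≤ (2 * (C + 1)) * ‖x - y‖ := by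
    intro x hx y hy
    have hx' : ‖x‖ ≤ 1 := by simpa [B] using hx
    have hy' : 1 < ‖y‖ := by simpa [B] using hy
    have hy0 : 0 < ‖y‖ := by linarith
    let z := ‖y‖⁻¹ • y
    have hz : ‖z‖ = 1 := by simp [z, norm_smul, hy0.ne']
    have hyz : ‖y - z‖ = ‖y‖ - 1 := by
      have : y - z = (1 - ‖y‖⁻¹) • y := by simp [z, sub_smul]
      rw [this, norm_smul, Real.norm_of_nonneg (by
        have := inv_le_one_of_one_le₀ hy'.le; linarith)]
      field_simp
    have h1 := key x hx z (by simp [B, hz])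
    rw [gout z hz.ge] at h1
    rw [gout y hy'.le]
    have h2 : ‖x - z‖ ≤ 2 * ‖x - y‖ := by
      have h3 : ‖x - z‖ ≤ ‖x - y‖ + ‖y - z‖ := norm_sub_le_norm_sub_add_norm_sub x y z
      have h4 : ‖y‖ - ‖x‖ ≤ ‖x - y‖ := by rw [norm_sub_rev]; exact norm_sub_norm_le y x
      linarith
    calc _ ≤ (C + 1) * ‖x - z‖ := h1
      _ ≤ (C + 1) * (2 * ‖x - y‖) := by gcongr
      _ = _ := by ring
  have hgL : LipschitzWith ⟨2 * (C + 1), by positivity⟩ g := by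
    apply LipschitzWith.of_dist_le_mul
    intro x y
    rw [dist_eq_norm, dist_eq_norm]
    show _ ≤ (2 * (C + 1)) * _
    by_cases hx : x ∈ B <;> by_cases hy : y ∈ B
    · refine (key x hx y hy).trans ?_
      gcongr
      linarith
    · exact key2 x hx y hy
    · rw [norm_sub_rev, norm_sub_rev x y]
      exact key2 y hy x hx
    · rw [gout x (by simp [B] at hx; exact hx.le), gout y (by simp [B] at hy; exact hy.le)]
      simp; positivity
  -- derivative
  let D : ℝ → E → E →L[ℝ] E := fun t x =>
    ContinuousLinearMap.id ℝ E + t • (fderiv ℝ r x - ContinuousLinearMap.id ℝ E)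
  have hDcont : ∀ t, ∀ x ∈ B, ContinuousAt (fun z : ℝ × E => (D z.1 z.2).det) (t, x) := by
    intro t x hx
    refine ContinuousLinearMap.continuous_det.continuousAt.comp ?_
    have : ContinuousAt (fun z : ℝ × E => fderiv ℝ r z.2) (t, x) :=
      ContinuousAt.comp (f := Prod.snd) (hD x hx) continuousAt_snd
    exact continuousAt_const.add (continuousAt_fst.smul (this.sub continuousAt_const))
  have hpos : ∀ᶠ t in 𝓝 (0 : ℝ), ∀ x ∈ B, 0 < (D t x).det := by
    apply hBc.eventually_forall_of_forall_eventually
    intro x hx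
    apply (hDcont 0 x hx).eventually (lt_mem_nhds _)
    simp [D, ContinuousLinearMap.det]
  let S := Metric.ball (0 : E) 1
  have hSB : S ⊆ B := Metric.ball_subset_closedBall
  have hintegr : ∀ t, MeasureTheory.IntegrableOn (fun x => (D t x).det) S := by
    intro t
    have : ContinuousOn (fun x => (D t x).det) B := fun x hx =>
      (ContinuousAt.comp (f := fun x => (t, x)) (hDcont t x hx)
        (by fun_prop)).continuousWithinAt
    exact (this.integrableOn_compact hBc).mono_set hSB
  have hvol : ∀ t : ℝ, 0 ≤ t → t * (2 * (C + 1)) < 1 → (∀ x ∈ B, 0 < (D t x).det) →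
      ∫ x in S, (D t x).det = MeasureTheory.volume.real S := by
    intro t ht0 ht hp
    have hbij := aux_perturb_bij g _ hgL t ht0 ht
    have himc : (fun x => x + t • g x) '' Sᶜ = Sᶜ := by
      have : Set.EqOn (fun x => x + t • g x) id Sᶜ := by
        intro x hx
        have hx' : 1 ≤ ‖x‖ := by simpa [S] using hx
        simp [gout x hx']
      rw [this.image_eq, Set.image_id]
    have him : (fun x => x + t • g x) '' S = S := by
      rw [Set.image_compl_eq hbij] at himc
      exact compl_injective himc
    have h1 := MeasureTheory.integral_image_eq_integral_abs_det_fderiv_smul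
      (MeasureTheory.volume : MeasureTheory.Measure E) (s := S) (f := fun x => x + t • g x) (f' := D t)
      Metric.isOpen_ball.measurableSet (by
        intro x hx
        have : HasFDerivAt (fun x => x + t • (r x - x)) (D t x) x :=
          (hasFDerivAt_id x).add (((hdiff x (hSB hx)).hasFDerivAt.sub (hasFDerivAt_id x)).const_smul t)
        refine (this.hasFDerivWithinAt).congr ?_ ?_
        · intro y hy
          have : ‖y‖ ≤ 1 := by simpa [B] using hSB hy
          simp [g, this]
        · have : ‖x‖ ≤ 1 := by simpa [B] using hSB hx
          simp [g, this]) hbij.injective.injOn (fun _ => (1 : ℝ))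
    rw [him] at h1
    simp only [smul_eq_mul, mul_one, MeasureTheory.integral_const, MeasureTheory.measureReal_restrict_apply_univ] at h1
    rw [h1]
    apply MeasureTheory.setIntegral_congr_fun Metric.isOpen_ball.measurableSet
    intro x hx
    exact (abs_of_pos (hp x (hSB hx))).symm
  -- choose nodes
  obtain ⟨ε, hε, hεp⟩ := Metric.eventually_nhds_iff.1 hpos
  let n := Module.finrank ℝ E
  let η := min (ε / 2) (1 / (4 * (C + 1)))
  have hη : 0 < η := by
    apply lt_min <;> positivity
  let τ : Fin (n + 1) → ℝ := fun i => η * ((i : ℕ) / ((n : ℝ) + 1))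
  have hτ0 : ∀ i, 0 ≤ τ i := fun i => by simp only [τ]; positivity
  have hτη : ∀ i, τ i ≤ η := fun i => by
    simp only [τ]
    apply mul_le_of_le_one_right hη.le
    rw [div_le_one (by positivity)]
    have := i.2
    exact_mod_cast this.le
  have hτinj : Function.Injective τ := by
    intro i j hij
    simp only [τ] at hij
    have h1 := mul_left_cancel₀ hη.ne' hij
    have : ((n : ℝ) + 1) ≠ 0 := by positivity
    rw [div_left_inj' this] at h1
    exact Fin.ext (by exact_mod_cast h1)
  have hv : ∀ i, ∫ x in S, (D (τ i) x).det = MeasureTheory.volume.real S := by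
    intro i
    apply hvol _ (hτ0 i)
    · have h1 : τ i ≤ 1 / (4 * (C + 1)) := (hτη i).trans (min_le_right _ _)
      have : (0:ℝ) < C + 1 := by positivity
      calc τ i * (2 * (C+1)) ≤ 1 / (4 * (C + 1)) * (2 * (C+1)) := by gcongr
        _ = 1 / 2 := by field_simp; norm_num
        _ < 1 := by norm_num
    · apply hεp
      rw [Real.dist_eq, sub_zero, abs_of_nonneg (hτ0 i)]
      have := (hτη i).trans (min_le_left _ _)
      linarith
  let w : Fin (n + 1) → ℝ := fun i => (Lagrange.basis Finset.univ τ i).eval 1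
  have hw : ∑ i, w i = 1 := by
    have := aux_lagrange n τ hτinj 1 (by simp)
    simpa using this.symm
  have hd : ∀ x, (D 1 x).det = ∑ i, (D (τ i) x).det * w i := by
    intro x
    obtain ⟨q, hq, hqe⟩ := aux_det_poly (fderiv ℝ r x)
    have := aux_lagrange n τ hτinj q hq
    simpa only [hqe] using this
  have hz : ∀ x ∈ S, (D 1 x).det = 0 := by
    intro x hx
    have hx' := hSB hx
    have e : D 1 x = fderiv ℝ r x := by simp [D]
    rw [e]
    have hloc : (fun y => ‖r y‖ ^ 2) =ᶠ[𝓝 x] fun _ => (1 : ℝ) := by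
      filter_upwards [Metric.isOpen_ball.mem_nhds hx] with y hy
      rw [hr1 y (hSB hy), one_pow]
    have h1 := ((hdiff x hx').hasFDerivAt.norm_sq).unique
      ((hasFDerivAt_const (1:ℝ) x).congr_of_eventuallyEq hloc)
    by_contra hne
    have hu : IsUnit (LinearMap.det (fderiv ℝ r x : E →ₗ[ℝ] E)) := isUnit_iff_ne_zero.2 hne
    have hsurj := (LinearMap.equivOfIsUnitDet hu).surjective (r x)
    obtain ⟨v, hv⟩ := hsurj
    have hv' : fderiv ℝ r x v = r x := by
      rw [LinearMap.equivOfIsUnitDet_apply] at hv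
      exact hv
    have h2 := congrArg (fun L : E →L[ℝ] ℝ => L v) h1
    simp [hv', hr1 x hx'] at h2
  have h0 : ∫ x in S, (D 1 x).det = 0 := by
    rw [MeasureTheory.setIntegral_congr_fun Metric.isOpen_ball.measurableSet hz]; simp
  have hfin : ∫ x in S, (D 1 x).det = MeasureTheory.volume.real S := by
    simp_rw [hd]
    rw [MeasureTheory.integral_finsetSum _ (fun i _ => (hintegr (τ i)).mul_const _)]
    simp_rw [MeasureTheory.integral_mul_const, hv]
    rw [← Finset.mul_sum, hw, mul_one]
  rw [h0] at hfin
  have hpos' : 0 < MeasureTheory.volume.real S :=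
    ENNReal.toReal_pos (Metric.measure_ball_pos _ _ one_pos).ne' MeasureTheory.measure_ball_lt_top.ne
  linarith
end Brouwer

section Brouwer
variable {E : Type*} [NormedAddCommGroup E] [InnerProductSpace ℝ E] [FiniteDimensional ℝ E]

lemma brouwer_smooth (g : E → E) (hg : ContDiff ℝ 1 g) (hg1 : ∀ x, ‖g x‖ ≤ 1) :
    ∃ x ∈ Metric.closedBall (0 : E) 1, g x = x := by
  by_contra hcon
  push Not at hcon
  let u : E → E := fun x => x - g x
  let p : E → ℝ := fun x => inner ℝ x (u x)
  let δ : E → ℝ := fun x => p x ^ 2 + ‖u x‖ ^ 2 * (1 - ‖x‖ ^ 2)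
  let l : E → ℝ := fun x => (-p x + Real.sqrt (δ x)) / ‖u x‖ ^ 2
  have hu : ∀ x ∈ Metric.closedBall (0 : E) 1, u x ≠ 0 := fun x hx h =>
    hcon x hx (sub_eq_zero.1 h).symm
  have hu2 : ∀ x ∈ Metric.closedBall (0 : E) 1, 0 < ‖u x‖ ^ 2 := fun x hx => by
    have := norm_pos_iff.2 (hu x hx); positivity
  have hp : ∀ x, ‖x‖ = 1 → 0 < p x := by
    intro x hx
    have hux := hu2 x (by simp [hx])
    have h1 : ‖u x‖ ^ 2 = ‖x‖ ^ 2 - 2 * inner ℝ x (g x) + ‖g x‖ ^ 2 := norm_sub_sq_real x (g x)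
    have h2 : p x = ‖x‖ ^ 2 - inner ℝ x (g x) := by
      simp only [p, u, inner_sub_right, real_inner_self_eq_norm_sq]
    have h3 : ‖g x‖ ^ 2 ≤ 1 := by
      have := hg1 x; have := norm_nonneg (g x); nlinarith
    rw [hx] at h1 h2
    nlinarith
  have hδ : ∀ x ∈ Metric.closedBall (0 : E) 1, 0 < δ x := by
    intro x hx
    have hx' : ‖x‖ ≤ 1 := by simpa using hx
    rcases hx'.lt_or_eq with h | h
    · have : 0 < 1 - ‖x‖ ^ 2 := by have := norm_nonneg x; nlinarith
      have := hu2 x hx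
      simp only [δ]; positivity
    · have := hp x h
      simp only [δ, h]; norm_num; positivity
  have hucd : ContDiff ℝ 1 u := contDiff_id.sub hg
  have hpcd : ContDiff ℝ 1 p := contDiff_id.inner ℝ hucd
  have hucd2 : ContDiff ℝ 1 (fun x => ‖u x‖ ^ 2) := hucd.norm_sq ℝ
  have hδcd : ContDiff ℝ 1 δ :=
    (hpcd.pow 2).add (hucd2.mul (contDiff_const.sub (contDiff_id.norm_sq ℝ)))
  apply no_retraction (fun x => x + l x • u x)
  · intro x hx
    refine contDiffAt_id.add (ContDiffAt.smul ?_ hucd.contDiffAt)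
    exact (hpcd.contDiffAt.neg.add (hδcd.contDiffAt.sqrt (hδ x hx).ne')).div hucd2.contDiffAt (hu2 x hx).ne'
  · intro x hx
    have h1 : ‖x + l x • u x‖ ^ 2 = 1 := by
      rw [norm_add_sq_real, inner_smul_right, norm_smul, mul_pow, Real.norm_eq_abs, sq_abs]
      have hne := (hu2 x hx).ne'
      have hs := Real.sq_sqrt (hδ x hx).le
      have hl : l x * ‖u x‖ ^ 2 = -p x + Real.sqrt (δ x) := by
        exact div_mul_cancel₀ _ hne
      have h2 : (l x * ‖u x‖ ^ 2 + p x) ^ 2 = δ x := by rw [hl, neg_add_cancel_comm, hs]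
      simp only [δ] at h2
      change ‖x‖ ^ 2 + 2 * (l x * p x) + l x ^ 2 * ‖u x‖ ^ 2 = 1
      have h3 : ‖u x‖ ^ 2 * (‖x‖ ^ 2 + 2 * (l x * p x) + l x ^ 2 * ‖u x‖ ^ 2) = ‖u x‖ ^ 2 * 1 := by
        linear_combination h2
      exact mul_left_cancel₀ hne h3
    have := norm_nonneg (x + l x • u x)
    exact (sq_eq_sq₀ this zero_le_one).1 (by rw [h1, one_pow])
  · intro x hx
    have h1 := hp x hx
    have h2 : δ x = p x ^ 2 := by simp [δ, hx]
    have : l x = 0 := by simp [l, h2, Real.sqrt_sq h1.le]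
    simp [this]

lemma clamp_continuous : Continuous (fun x : E => (max 1 ‖x‖)⁻¹ • x) := by
  refine Continuous.smul (Continuous.inv₀ (by fun_prop) ?_) continuous_id
  intro x
  have : (1:ℝ) ≤ max 1 ‖x‖ := le_max_left _ _
  positivity

lemma clamp_mem (x : E) : (max 1 ‖x‖)⁻¹ • x ∈ Metric.closedBall (0 : E) 1 := by
  have h1 : (1:ℝ) ≤ max 1 ‖x‖ := le_max_left _ _
  have h2 : ‖x‖ ≤ max 1 ‖x‖ := le_max_right _ _
  have h3 : 0 < max 1 ‖x‖ := by linarith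
  rw [mem_closedBall_zero_iff, norm_smul, norm_inv, Real.norm_of_nonneg h3.le, inv_mul_le_iff₀ h3]
  simpa using h2

lemma brouwer (f : E → E) (hf : ContinuousOn f (Metric.closedBall (0 : E) 1))
    (hf1 : ∀ x ∈ Metric.closedBall (0 : E) 1, ‖f x‖ ≤ 1) :
    ∃ x ∈ Metric.closedBall (0 : E) 1, f x = x := by
  by_contra hcon
  push Not at hcon
  obtain ⟨x₀, hx₀, hmin⟩ := (isCompact_closedBall (0 : E) 1).exists_isMinOn ⟨0, by simp⟩
    (hf.sub continuousOn_id).norm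
  let δ := ‖f x₀ - x₀‖
  have hδ : 0 < δ := norm_pos_iff.2 (sub_ne_zero.2 (hcon x₀ hx₀))
  have hδ2 : ∀ x ∈ Metric.closedBall (0 : E) 1, δ ≤ ‖f x - x‖ := fun x hx => hmin hx
  let F : E → E := fun x => f ((max 1 ‖x‖)⁻¹ • x)
  have hF : Continuous F := hf.comp_continuous clamp_continuous clamp_mem
  let ε := δ / 4
  have hε : 0 < ε := by simp only [ε]; positivity
  obtain ⟨h, hh, hha, -⟩ := hF.exists_contDiff_approx (ε := fun _ => ε) 1 continuous_const (fun _ => hε)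
  have hh1 : ∀ x, ‖h x‖ ≤ 1 + ε := by
    intro x
    have h1 := (hha x).le
    rw [dist_eq_norm] at h1
    have h2 : ‖F x‖ ≤ 1 := hf1 _ (clamp_mem x)
    have h3 := norm_le_norm_add_norm_sub' (h x) (F x)
    linarith
  have hg1 : ∀ x, ‖(1 + ε)⁻¹ • h x‖ ≤ 1 := by
    intro x
    rw [norm_smul, norm_inv, Real.norm_of_nonneg (by positivity), inv_mul_le_iff₀ (by positivity)]
    simpa using hh1 x
  obtain ⟨x, hx, hxe⟩ := brouwer_smooth (fun x => (1 + ε)⁻¹ • h x) (contDiff_const.smul hh) hg1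
  have hx' : ‖x‖ ≤ 1 := by simpa using hx
  have hFx : F x = f x := by simp [F, max_eq_left hx']
  have h1 := (hha x).le
  rw [dist_eq_norm, hFx] at h1
  have h2 := hδ2 x hx
  have h3 : h x = (1 + ε) • x := by
    exact (inv_smul_eq_iff₀ (by positivity : (1 + ε) ≠ 0)).1 hxe
  have h4 : ‖h x - x‖ ≤ ε := by
    rw [h3, add_smul, one_smul, add_sub_cancel_left, norm_smul, Real.norm_of_nonneg hε.le]
    exact mul_le_of_le_one_right hε.le hx'
  have h5 := norm_sub_le_norm_sub_add_norm_sub (f x) (h x) x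
  rw [norm_sub_rev (f x) (h x)] at h5
  simp only [ε] at h1 h4
  linarith

end Brouwer

section Brouwer
variable {E : Type*} [NormedAddCommGroup E] [InnerProductSpace ℝ E] [FiniteDimensional ℝ E]

lemma invariance_ball (f : E → E) (hf : ContinuousOn f (Metric.closedBall (0 : E) 1))
    (hinj : Set.InjOn f (Metric.closedBall (0 : E) 1)) :
    f '' Metric.closedBall (0 : E) 1 ∈ 𝓝 (f 0) := by
  rcases subsingleton_or_nontrivial E with hE | hE
  · have : f '' Metric.closedBall (0 : E) 1 = Set.univ := by
      apply Set.eq_univ_of_forall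
      intro y
      exact ⟨0, by simp, Subsingleton.elim _ _⟩
    rw [this]; exact univ_mem
  let _ : MeasurableSpace E := borel E
  have _ : BorelSpace E := ⟨rfl⟩
  let B := Metric.closedBall (0 : E) 1
  have hBc : IsCompact B := isCompact_closedBall 0 1
  have h0B : (0 : E) ∈ B := by simp [B]
  let K := f '' B
  have hKc : IsCompact K := hBc.image_of_continuousOn hf
  obtain ⟨G, hG⟩ : ∃ G : C(E, E), ∀ x ∈ B, G (f x) = x := by
    have _ : CompactSpace B := isCompact_iff_compactSpace.1 hBc
    have he : IsClosedEmbedding (B.domRestrict f) :=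
      (continuousOn_iff_continuous_domRestrict.1 hf).isClosedEmbedding (Set.injOn_iff_injective.1 hinj)
    have _ : TietzeExtension E := TietzeExtension.of_tvs ℝ
    obtain ⟨G, hG⟩ := ContinuousMap.exists_extension' he (⟨Subtype.val, continuous_subtype_val⟩ : C(B, E))
    exact ⟨G, fun x hx => congrFun hG ⟨x, hx⟩⟩
  have hstab : ∀ H : E → E, ContinuousOn H K → (∀ y ∈ K, ‖G y - H y‖ ≤ 1) → ∃ y ∈ K, H y = 0 := by
    intro H hH hd
    obtain ⟨x, hx, hxe⟩ := brouwer (fun x => x - H (f x))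
      (continuousOn_id.sub (hH.comp hf (Set.mapsTo_image f B))) (by
        intro x hx
        have := hd (f x) ⟨x, hx, rfl⟩
        rwa [hG x hx] at this)
    exact ⟨f x, ⟨x, hx, rfl⟩, by simpa using hxe⟩
  by_contra hcon
  have hG0 : G (f 0) = 0 := hG 0 h0B
  obtain ⟨ε₀, hε₀, hGε⟩ := Metric.continuousAt_iff.1 (G.continuous.continuousAt (x := f 0)) (1/10) (by norm_num)
  let ε := ε₀ / 3
  have hε : 0 < ε := by simp only [ε]; positivity
  have hnot : ¬ Metric.ball (f 0) ε ⊆ K := fun h => hcon (mem_of_superset (Metric.ball_mem_nhds _ hε) h)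
  obtain ⟨c, hc, hcK⟩ := Set.not_subset.1 hnot
  rw [Metric.mem_ball, dist_comm] at hc
  have hGc : ∀ y, ‖y - c‖ ≤ ε → ‖G y‖ < 1/10 := by
    intro y hy
    have h1 : dist y (f 0) < ε₀ := by
      have := dist_triangle y c (f 0)
      rw [dist_comm c, dist_eq_norm y c] at this
      simp only [ε] at hy hc
      linarith
    have := hGε h1
    rwa [hG0, dist_zero_right] at this
  let Φ : E → E := fun y => c + (max (ε / ‖y - c‖) 1) • (y - c)
  have hΦ1 : ∀ y, ε ≤ ‖y - c‖ → Φ y = y := by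
    intro y hy
    have : ε / ‖y - c‖ ≤ 1 := (div_le_one (by linarith)).2 hy
    simp [Φ, max_eq_right this]
  have hΦ2 : ∀ y, y ≠ c → ‖y - c‖ ≤ ε → ‖Φ y - c‖ = ε := by
    intro y hyc hy
    have h0 : 0 < ‖y - c‖ := norm_pos_iff.2 (sub_ne_zero.2 hyc)
    have : 1 ≤ ε / ‖y - c‖ := (one_le_div h0).2 hy
    simp only [Φ, max_eq_left this, add_sub_cancel_left, norm_smul, norm_div, norm_norm,
      Real.norm_of_nonneg hε.le]
    field_simp
  have hKc' : ∀ y ∈ K, y ≠ c := fun y hy h => hcK (h ▸ hy)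
  have hΦc : ContinuousOn Φ K := by
    refine continuousOn_const.add (ContinuousOn.smul (ContinuousOn.sup ?_ continuousOn_const) (by fun_prop))
    refine ContinuousOn.div continuousOn_const (by fun_prop) ?_
    intro y hy
    exact (norm_pos_iff.2 (sub_ne_zero.2 (hKc' y hy))).ne'
  let S1 := K ∩ {y | ε ≤ ‖y - c‖}
  have hS1 : IsCompact S1 := hKc.inter_right (isClosed_le continuous_const (by fun_prop))
  obtain ⟨δ, hδ, hδG⟩ : ∃ δ : ℝ, 0 < δ ∧ ∀ y ∈ S1, δ ≤ ‖G y‖ := by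
    refine hS1.exists_forall_le' (G.continuous.norm.continuousOn) ?_
    rintro y ⟨⟨x, hx, rfl⟩, hy⟩
    rw [norm_pos_iff, hG x hx]
    rintro rfl
    simp only [Set.mem_ofPred_eq, ← dist_eq_norm] at hy
    linarith
  let η := min (δ / 3) (1 / 10)
  have hη : 0 < η := by apply lt_min <;> positivity
  have hη1 : η ≤ δ / 3 := min_le_left _ _
  have hη2 : η ≤ 1 / 10 := min_le_right _ _
  obtain ⟨P, hP, hPa, -⟩ := G.continuous.exists_contDiff_approx (ε := fun _ => η) 1 continuous_const (fun _ => hη)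
  have hnull : MeasureTheory.volume (P '' Metric.sphere c ε) = 0 :=
    MeasureTheory.addHaar_image_eq_zero_of_differentiableOn_of_addHaar_eq_zero _
      (hP.differentiable (by simp)).differentiableOn (MeasureTheory.Measure.addHaar_sphere _ _ _)
  obtain ⟨v, hv, hvP⟩ : ∃ v ∈ Metric.ball (0 : E) η, v ∉ P '' Metric.sphere c ε := by
    by_contra hh
    push Not at hh
    have := MeasureTheory.measure_mono_null (μ := MeasureTheory.volume) (show Metric.ball (0 : E) η ⊆ _ from hh) hnull
    exact (Metric.measure_ball_pos MeasureTheory.volume (0 : E) hη).ne' this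
  rw [mem_ball_zero_iff] at hv
  have hQ : ∀ y, ‖G y - (P y - v)‖ < 2 * η := by
    intro y
    have h1 := hPa y
    rw [dist_comm, dist_eq_norm] at h1
    calc ‖G y - (P y - v)‖ = ‖(G y - P y) + v‖ := by congr 1; abel
      _ ≤ ‖G y - P y‖ + ‖v‖ := norm_add_le _ _
      _ < 2 * η := by linarith
  obtain ⟨y, hyK, hy0⟩ := hstab (fun y => P (Φ y) - v)
    ((hP.continuous.comp_continuousOn hΦc).sub continuousOn_const) (by
      intro y hy
      rcases le_total ε ‖y - c‖ with h | h
      · rw [hΦ1 y h]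
        have := hQ y
        linarith
      · have h1 := hGc y h
        have h2 := hGc (Φ y) (hΦ2 y (hKc' y hy) h).le
        have h3 := hQ (Φ y)
        have h4 := norm_sub_le (G y) (P (Φ y) - v)
        have h5 := norm_le_norm_add_norm_sub (G (Φ y)) (P (Φ y) - v)
        linarith)
  rcases le_total ε ‖y - c‖ with h | h
  · have h1 := hδG y ⟨hyK, h⟩
    have h2 := hQ y
    simp only [hΦ1 y h] at hy0
    rw [hy0, sub_zero] at h2
    linarith
  · refine hvP ⟨Φ y, ?_, sub_eq_zero.1 hy0⟩
    rw [Metric.mem_sphere, dist_eq_norm]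
    exact hΦ2 y (hKc' y hyK) h

lemma invariance_domain (f : E → E) (U : Set E) (hU : IsOpen U) (hf : ContinuousOn f U)
    (hinj : Set.InjOn f U) : IsOpen (f '' U) := by
  rw [isOpen_iff_mem_nhds]
  rintro _ ⟨x, hx, rfl⟩
  obtain ⟨ρ, hρ, hsub⟩ := Metric.nhds_basis_closedBall.mem_iff.1 (hU.mem_nhds hx)
  let s : E → E := fun y => x + ρ • y
  have hs : ∀ y ∈ Metric.closedBall (0 : E) 1, s y ∈ U := by
    intro y hy
    apply hsub
    have : ‖y‖ ≤ 1 := by simpa using hy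
    simp only [s, Metric.mem_closedBall, dist_eq_norm, add_sub_cancel_left, norm_smul, Real.norm_of_nonneg hρ.le]
    exact mul_le_of_le_one_right hρ.le this
  have h := invariance_ball (f ∘ s) (hf.comp (by fun_prop) hs) (by
    intro a ha b hb hab
    have := hinj (hs a ha) (hs b hb) hab
    simpa [s, hρ.ne'] using this)
  have h0 : (f ∘ s) 0 = f x := by simp [s]
  rw [h0] at h
  refine mem_of_superset h ?_
  rintro _ ⟨y, hy, rfl⟩
  exact ⟨s y, hs y hy, rfl⟩

lemma dim_le_of_inj (V W : Submodule ℝ E) (U : Set E) (hU : IsOpen U) (a : E) (haU : a ∈ U)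
    (haV : a ∈ V) (f : E → E) (hf : ContinuousOn f U) (hinj : Set.InjOn f U)
    (hVW : ∀ x ∈ U, x ∈ V → f x ∈ W) : Module.finrank ℝ V ≤ Module.finrank ℝ W := by
  by_contra hlt
  push Not at hlt
  obtain ⟨L, hL⟩ := Module.Free.exists_linearMap_injective_of_rank_lt (R := ℝ) (M := W) (N := V) (by
    rw [← Module.finrank_eq_rank, ← Module.finrank_eq_rank]; exact_mod_cast hlt)
  let U' : Set V := Subtype.val ⁻¹' U
  have hU' : IsOpen U' := hU.preimage continuous_subtype_val
  let g : V → V := fun v => L (W.orthogonalProjectionOnto (f v))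
  have hg : ContinuousOn g U' :=
    (L.continuous_of_finiteDimensional.comp (ContinuousLinearMap.continuous _)).comp_continuousOn
      (hf.comp continuous_subtype_val.continuousOn (fun _ h => h))
  have hginj : Set.InjOn g U' := by
    intro x hx y hy hxy
    have h1 := hL hxy
    have h2 := congrArg (Subtype.val : W → E) h1
    change W.starProjection (f x) = W.starProjection (f y) at h2
    rw [Submodule.starProjection_eq_self_iff.2 (hVW x hx x.2), Submodule.starProjection_eq_self_iff.2 (hVW y hy y.2)] at h2
    exact Subtype.ext (hinj hx hy h2)
  have hopen := invariance_domain g U' hU' hg hginj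
  have htop : LinearMap.range L = ⊤ := by
    apply Submodule.eq_top_of_nonempty_interior'
    refine ⟨g ⟨a, haV⟩, ?_⟩
    refine interior_maximal ?_ hopen ⟨⟨a, haV⟩, haU, rfl⟩
    rintro _ ⟨y, -, rfl⟩
    exact ⟨_, rfl⟩
  have h1 := LinearMap.finrank_range_of_inj hL
  rw [htop, finrank_top] at h1
  omega

lemma dim_eq_of_inj (V W : Submodule ℝ E) (U : Set E) (hU : IsOpen U) (a : E) (haU : a ∈ U)
    (haV : a ∈ V) (f : E → E) (hf : ContinuousOn f U) (hinj : Set.InjOn f U)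
    (hVW : ∀ x ∈ U, x ∈ V ↔ f x ∈ W) : Module.finrank ℝ V = Module.finrank ℝ W := by
  apply le_antisymm
  · exact dim_le_of_inj V W U hU a haU haV f hf hinj (fun x hx => (hVW x hx).1)
  · have hl : ∀ x ∈ U, Function.invFunOn f U (f x) = x := fun x hx => hinj.leftInvOn_invFunOn hx
    refine dim_le_of_inj W V (f '' U) (invariance_domain f U hU hf hinj) (f a) ⟨a, haU, rfl⟩
      ((hVW a haU).1 haV) (Function.invFunOn f U) ?_ ?_ ?_
    · rw [continuousOn_open_iff (invariance_domain f U hU hf hinj)]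
      intro t ht
      have : f '' U ∩ Function.invFunOn f U ⁻¹' t = f '' (U ∩ t) := by
        ext y
        constructor
        · rintro ⟨⟨x, hx, rfl⟩, h⟩
          rw [Set.mem_preimage, hl x hx] at h
          exact ⟨x, ⟨hx, h⟩, rfl⟩
        · rintro ⟨x, ⟨hx, h⟩, rfl⟩
          exact ⟨⟨x, hx, rfl⟩, by rw [Set.mem_preimage, hl x hx]; exact h⟩
      rw [this]
      exact invariance_domain f _ (hU.inter ht) (hf.mono Set.inter_subset_left) (hinj.mono Set.inter_subset_left)
    · rintro _ ⟨x, hx, rfl⟩ _ ⟨y, hy, rfl⟩ h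
      rw [hl x hx, hl y hy] at h
      rw [h]
    · rintro _ ⟨x, hx, rfl⟩ h
      rw [hl x hx]
      exact (hVW x hx).2 h

end Brouwer

lemma count_perm {m : ℕ} (b c : Fin m → ℝ) (hb : ∀ j, 0 < b j) (hc : ∀ j, 0 < c j)
    (h : ∀ β : ℝ, 0 < β → Nat.card {j // ∃ k : ℤ, b j = k * β} = Nat.card {j // ∃ k : ℤ, c j = k * β}) :
    ∃ p : Fin m ≃ Fin m, ∀ j, b j = c (p j) := by
  classical
  have hcnt : ∀ β, (Finset.univ.filter fun j => b j = β).card = (Finset.univ.filter fun j => c j = β).card := by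
    by_contra hne
    push Not at hne
    let V : Finset ℝ := Finset.univ.image b ∪ Finset.univ.image c
    have hbV : ∀ j, b j ∈ V := fun j => Finset.mem_union_left _ (Finset.mem_image_of_mem _ (Finset.mem_univ _))
    have hcV : ∀ j, c j ∈ V := fun j => Finset.mem_union_right _ (Finset.mem_image_of_mem _ (Finset.mem_univ _))
    have hV0 : ∀ γ ∈ V, 0 < γ := by
      intro γ hγ
      simp only [V, Finset.mem_union, Finset.mem_image, Finset.mem_univ, true_and] at hγ
      rcases hγ with ⟨j, rfl⟩ | ⟨j, rfl⟩
      · exact hb j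
      · exact hc j
    let W := V.filter fun β => (Finset.univ.filter fun j => b j = β).card ≠ (Finset.univ.filter fun j => c j = β).card
    have hW : W.Nonempty := by
      obtain ⟨β, hβ⟩ := hne
      refine ⟨β, Finset.mem_filter.2 ⟨?_, hβ⟩⟩
      by_contra hβV
      apply hβ
      rw [Finset.filter_false_of_mem, Finset.filter_false_of_mem]
      · rintro j - rfl; exact hβV (hcV j)
      · rintro j - rfl; exact hβV (hbV j)
    obtain ⟨β, hβW, hmax⟩ := W.exists_max_image id hW
    obtain ⟨hβV, hβne⟩ := Finset.mem_filter.1 hβW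
    have hβ0 := hV0 β hβV
    have hsplit : ∀ a : Fin m → ℝ, (∀ j, a j ∈ V) → Nat.card {j // ∃ k : ℤ, a j = k * β} =
        ∑ γ ∈ V.filter (fun γ => ∃ k : ℤ, γ = k * β), (Finset.univ.filter fun j => a j = γ).card := by
      intro a ha
      rw [Nat.card_eq_fintype_card, Fintype.card_subtype,
        Finset.card_eq_sum_card_fiberwise (f := a) (t := V.filter (fun γ => ∃ k : ℤ, γ = k * β))]
      · apply Finset.sum_congr rfl
        intro γ hγ
        congr 1
        ext j
        simp only [Finset.mem_filter, Finset.mem_univ, true_and] at hγ ⊢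
        constructor
        · exact fun h => h.2
        · rintro rfl; exact ⟨hγ.2, rfl⟩
      · intro j hj
        simp only [Finset.coe_filter, Finset.mem_univ, true_and, Set.mem_ofPred_eq] at hj ⊢
        exact ⟨ha j, hj⟩
    have hh := h β hβ0
    have hβmem : β ∈ V.filter (fun γ => ∃ k : ℤ, γ = k * β) :=
      Finset.mem_filter.2 ⟨hβV, 1, by simp⟩
    rw [hsplit b hbV, hsplit c hcV, ← Finset.add_sum_erase _ _ hβmem, ← Finset.add_sum_erase _ _ hβmem] at hh
    have hrest : ∀ γ ∈ (V.filter (fun γ => ∃ k : ℤ, γ = k * β)).erase β,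
        (Finset.univ.filter fun j => b j = γ).card = (Finset.univ.filter fun j => c j = γ).card := by
      intro γ hγ
      obtain ⟨hγne, hγ⟩ := Finset.mem_erase.1 hγ
      obtain ⟨hγV, k, hk⟩ := Finset.mem_filter.1 hγ
      by_contra hcon
      have h1 : γ ≤ β := hmax γ (Finset.mem_filter.2 ⟨hγV, hcon⟩)
      have h2 := hV0 γ hγV
      have hk0 : 0 < k := by
        rw [hk] at h2
        exact_mod_cast pos_of_mul_pos_left h2 hβ0.le
      have hk1 : (1:ℝ) ≤ k := by exact_mod_cast hk0
      apply hγne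
      nlinarith
    rw [Finset.sum_congr rfl hrest] at hh
    exact hβne (Nat.add_right_cancel hh)
  have e : ∀ β, Nonempty ({j // b j = β} ≃ {j // c j = β}) := by
    intro β
    rw [← Fintype.card_eq, Fintype.card_subtype, Fintype.card_subtype, hcnt]
  refine ⟨Equiv.ofFiberEquiv (f := b) (g := c) (fun β => (e β).some), fun j => ?_⟩
  exact (Equiv.ofFiberEquiv_map _ j).symm

/-- minimal-period determines a closed subgroup -/
lemma closed_subgroup_le (P Q : AddSubgroup ℝ) (hP : IsClosed (P : Set ℝ)) (hQ : IsClosed (Q : Set ℝ))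
    (h : sInf {T : EReal | ∃ t : ℝ, 0 < t ∧ t ∈ P ∧ T = (t : EReal)} =
      sInf {T : EReal | ∃ t : ℝ, 0 < t ∧ t ∈ Q ∧ T = (t : EReal)}) : P ≤ Q := by
  have hcl : ∀ S : AddSubgroup ℝ, IsClosed (S : Set ℝ) →
      (S = ⊤ ∧ sInf {T : EReal | ∃ t : ℝ, 0 < t ∧ t ∈ S ∧ T = (t : EReal)} = 0) ∨
      (S = ⊥ ∧ sInf {T : EReal | ∃ t : ℝ, 0 < t ∧ t ∈ S ∧ T = (t : EReal)} = ⊤) ∨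
      ∃ a : ℝ, 0 < a ∧ S = AddSubgroup.zmultiples a ∧ sInf {T : EReal | ∃ t : ℝ, 0 < t ∧ t ∈ S ∧ T = (t : EReal)} = a := by
    intro S hS
    rcases S.dense_or_cyclic with hd | ⟨a, ha⟩
    · left
      have hS' : S = ⊤ := by
        apply SetLike.coe_injective
        rw [← hS.closure_eq, hd.closure_eq]; rfl
      refine ⟨hS', le_antisymm ?_ ?_⟩
      · apply le_of_forall_gt
        intro x hx
        obtain ⟨t, ht0, htx⟩ := EReal.lt_iff_exists_real_btwn.1 hx
        refine lt_of_le_of_lt (sInf_le ⟨t, by exact_mod_cast ht0, by simp [hS'], rfl⟩) htx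
      · apply le_sInf
        rintro _ ⟨t, ht, -, rfl⟩
        exact_mod_cast ht.le
    · right
      rw [← AddSubgroup.zmultiples_eq_closure] at ha
      rcases eq_or_ne a 0 with rfl | ha0
      · left
        have hS' : S = ⊥ := by rw [ha, AddSubgroup.zmultiples_zero_eq_bot]
        refine ⟨hS', ?_⟩
        rw [sInf_eq_top]
        rintro _ ⟨t, ht, htS, rfl⟩
        rw [hS', AddSubgroup.mem_bot] at htS
        exact absurd htS ht.ne'
      · right
        have ha' : S = AddSubgroup.zmultiples |a| := by
          rcases abs_choice a with h | h <;> rw [h, ha]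
          rw [AddSubgroup.zmultiples_neg]
        refine ⟨|a|, abs_pos.2 ha0, ha', le_antisymm ?_ ?_⟩
        · exact sInf_le ⟨|a|, abs_pos.2 ha0, by rw [ha']; exact AddSubgroup.mem_zmultiples _, rfl⟩
        · apply le_sInf
          rintro _ ⟨t, ht, htS, rfl⟩
          rw [ha', AddSubgroup.mem_zmultiples_iff] at htS
          obtain ⟨k, rfl⟩ := htS
          rw [zsmul_eq_mul] at ht ⊢
          have hk : 0 < k := by exact_mod_cast pos_of_mul_pos_left ht (abs_nonneg a)
          have hk1 : (1:ℝ) ≤ k := by exact_mod_cast hk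
          have := abs_nonneg a
          have h3 : |a| ≤ k * |a| := by nlinarith
          exact_mod_cast h3
  rcases hcl P hP with ⟨hP1, hP2⟩ | ⟨hP1, hP2⟩ | ⟨a, ha, hP1, hP2⟩ <;>
  rcases hcl Q hQ with ⟨hQ1, hQ2⟩ | ⟨hQ1, hQ2⟩ | ⟨a', ha', hQ1, hQ2⟩ <;>
  rw [hP2, hQ2] at h
  · rw [hQ1]; exact le_top
  · simp at h
  · exact absurd (by exact_mod_cast h.symm) ha'.ne'
  · simp at h
  · rw [hP1]; exact bot_le
  · simp at h
  · exact absurd (by exact_mod_cast h) ha.ne'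
  · simp at h
  · have : a = a' := by exact_mod_cast h
    rw [hP1, hQ1, this]

section
attribute [local instance] Matrix.linftyOpNormedRing Matrix.linftyOpNormedAlgebra

lemma flow_hasDerivAt (A : Matrix (Fin d) (Fin d) ℝ) (l : Euc d →ₗ[ℝ] ℂ) (x : Euc d) (t : ℝ) :
    HasDerivAt (fun t => l (linFlow A t x)) (l (Matrix.toEuclideanLin A (linFlow A t x))) t := by
  let F : Matrix (Fin d) (Fin d) ℝ →ₗ[ℝ] ℂ :=
    l ∘ₗ (LinearMap.applyₗ x) ∘ₗ (Matrix.toEuclideanLin (𝕜 := ℝ) (m := Fin d) (n := Fin d)).toLinearMap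
  have h1 := hasDerivAt_exp_smul_const' (𝕂 := ℝ) A t
  have h2 := (LinearMap.toContinuousLinearMap F).hasFDerivAt.comp_hasDerivAt t h1
  refine h2.congr_deriv ?_
  change l (Matrix.toEuclideanLin (A * NormedSpace.exp (t • A)) x)
    = l (Matrix.toEuclideanLin A (linFlow A t x))
  congr 1
  simp [linFlow, Matrix.toEuclideanLin_apply, Matrix.mulVec_mulVec]

lemma flow_continuous (A : Matrix (Fin d) (Fin d) ℝ) (x : Euc d) :
    Continuous (fun t => linFlow A t x) := by
  let F : Matrix (Fin d) (Fin d) ℝ →ₗ[ℝ] Euc d :=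
    (LinearMap.applyₗ x) ∘ₗ (Matrix.toEuclideanLin (𝕜 := ℝ) (m := Fin d) (n := Fin d)).toLinearMap
  have h1 : Continuous (fun t : ℝ => NormedSpace.exp (t • A)) :=
    continuous_iff_continuousAt.2 fun t => (hasDerivAt_exp_smul_const' (𝕂 := ℝ) A t).continuousAt
  exact F.continuous_of_finiteDimensional.comp h1

lemma flow_zero (A : Matrix (Fin d) (Fin d) ℝ) (x : Euc d) : linFlow A 0 x = x := by
  simp [linFlow, Matrix.toEuclideanLin_apply]

lemma flow_add (A : Matrix (Fin d) (Fin d) ℝ) (s t : ℝ) (x : Euc d) :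
    linFlow A (s + t) x = linFlow A s (linFlow A t x) := by
  have : NormedSpace.exp ((s + t) • A) = NormedSpace.exp (s • A) * NormedSpace.exp (t • A) := by
    rw [add_smul]
    exact Matrix.exp_add_of_commute _ _ (((Commute.refl A).smul_left s).smul_right t)
  simp [linFlow, this, Matrix.toEuclideanLin_apply, Matrix.mulVec_mulVec]
end

lemma flow_functional (A : Matrix (Fin d) (Fin d) ℝ) (l : Euc d →ₗ[ℝ] ℂ) (μ : ℂ)
    (hl : ∀ x, l (Matrix.toEuclideanLin A x) = μ * l x) (t : ℝ) (x : Euc d) :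
    l (linFlow A t x) = Complex.exp (t * μ) * l x := by
  have hE : ∀ t : ℝ, HasDerivAt (fun t : ℝ => Complex.exp (-(t * μ))) (Complex.exp (-(t * μ)) * (-μ)) t := by
    intro t
    have h1 : HasDerivAt (fun t : ℝ => -((t : ℂ) * μ)) (-μ) t := by
      have h := ((Complex.ofRealCLM.hasDerivAt (x := t)).mul_const μ).fun_neg
      exact h.congr_deriv (by simp)
    exact h1.cexp
  have hc : ∀ t : ℝ, HasDerivAt (fun t : ℝ => Complex.exp (-(t * μ)) * l (linFlow A t x)) 0 t := by
    intro t
    refine ((hE t).mul (flow_hasDerivAt A l x t)).congr_deriv ?_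
    rw [hl]; ring
  have := is_const_of_deriv_eq_zero (fun t => (hc t).differentiableAt) (fun t => (hc t).deriv) t 0
  simp only [flow_zero] at this
  simp only [Complex.ofReal_zero, zero_mul, neg_zero, Complex.exp_zero, one_mul] at this
  rw [← this, ← mul_assoc, ← Complex.exp_add]
  simp

/-- complex coordinates -/
def rotCoord (m0 m d : ℕ) (h : m0 + 2 * m = d) : Euc d ≃ₗ[ℝ] (Fin m0 → ℝ) × (Fin m → ℂ) where
  toFun x := (fun i => x (rotEquiv m0 m d h (Sum.inl i)),
    fun j => ⟨x (rotEquiv m0 m d h (Sum.inr (0, j))), x (rotEquiv m0 m d h (Sum.inr (1, j)))⟩)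
  invFun w := WithLp.toLp 2 fun k => Sum.elim w.1
    (fun p => if p.1 = 0 then (w.2 p.2).re else (w.2 p.2).im) ((rotEquiv m0 m d h).symm k)
  map_add' x y := by
    refine Prod.ext (by ext; simp) (funext fun j => ?_)
    apply Complex.ext <;> simp
  map_smul' a x := by
    refine Prod.ext (by ext; simp) (funext fun j => ?_)
    apply Complex.ext <;> simp
  left_inv x := by
    ext k
    obtain ⟨p, rfl⟩ := (rotEquiv m0 m d h).surjective k
    rcases p with i | ⟨i, j⟩
    · simp
    · fin_cases i <;> simp
  right_inv w := by
    ext j <;> simp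

lemma rotBlock_apply (m0 m d : ℕ) (h : m0 + 2 * m = d) (b : Fin m → ℝ) (x : Euc d)
    (p : Fin m0 ⊕ (Fin 2 × Fin m)) :
    Matrix.toEuclideanLin (rotBlockMat m0 m d h b) x (rotEquiv m0 m d h p) =
      ∑ q, (Matrix.fromBlocks (0 : Matrix (Fin m0) (Fin m0) ℝ) 0 0 (Matrix.blockDiagonal fun j : Fin m => !![0, -(b j); b j, 0])) p q
        * x (rotEquiv m0 m d h q) := by
  rw [Matrix.toEuclideanLin_apply]
  simp only [Matrix.mulVec, dotProduct, rotBlockMat]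
  rw [← (rotEquiv m0 m d h).sum_comp]
  simp

lemma rotCoord_block1 (m0 m d : ℕ) (h : m0 + 2 * m = d) (b : Fin m → ℝ) (x : Euc d) (i : Fin m0) :
    (rotCoord m0 m d h (Matrix.toEuclideanLin (rotBlockMat m0 m d h b) x)).1 i = 0 := by
  simp only [rotCoord, LinearEquiv.coe_mk, LinearMap.coe_mk, AddHom.coe_mk]
  rw [rotBlock_apply]
  simp

lemma rotCoord_block2 (m0 m d : ℕ) (h : m0 + 2 * m = d) (b : Fin m → ℝ) (x : Euc d) (j : Fin m) :
    (rotCoord m0 m d h (Matrix.toEuclideanLin (rotBlockMat m0 m d h b) x)).2 j =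
      (b j * Complex.I) * (rotCoord m0 m d h x).2 j := by
  simp only [rotCoord, LinearEquiv.coe_mk, LinearMap.coe_mk, AddHom.coe_mk]
  rw [rotBlock_apply, rotBlock_apply]
  apply Complex.ext
  · simp [Fintype.sum_prod_type, Matrix.blockDiagonal_apply]
  · simp [Fintype.sum_prod_type, Matrix.blockDiagonal_apply]

lemma rotCoord_flow (m0 m d : ℕ) (h : m0 + 2 * m = d) (b : Fin m → ℝ) (t : ℝ) (x : Euc d) :
    rotCoord m0 m d h (linFlow (rotBlockMat m0 m d h b) t x) =
      ((rotCoord m0 m d h x).1, fun j => Complex.exp (t * (b j * Complex.I)) * (rotCoord m0 m d h x).2 j) := by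
  apply Prod.ext
  · funext i
    have := flow_functional (rotBlockMat m0 m d h b)
      (Complex.ofRealLI.toLinearMap ∘ₗ (LinearMap.proj i) ∘ₗ (LinearMap.fst ℝ _ _) ∘ₗ (rotCoord m0 m d h).toLinearMap) 0 (by
        intro x
        simp [rotCoord_block1]) t x
    simpa using this
  · funext j
    exact flow_functional (rotBlockMat m0 m d h b)
      ((LinearMap.proj j) ∘ₗ (LinearMap.snd ℝ _ _) ∘ₗ (rotCoord m0 m d h).toLinearMap) (b j * Complex.I) (by
        intro x
        simpa using rotCoord_block2 m0 m d h b x j) t x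

/-- period-`T` subspace -/
def perSub (A : Matrix (Fin d) (Fin d) ℝ) (T : ℝ) : Submodule ℝ (Euc d) :=
  LinearMap.ker (Matrix.toEuclideanLin (NormedSpace.exp (T • A)) - LinearMap.id)

lemma mem_perSub (A : Matrix (Fin d) (Fin d) ℝ) (T : ℝ) (x : Euc d) :
    x ∈ perSub A T ↔ linFlow A T x = x := by
  rw [perSub, LinearMap.mem_ker, LinearMap.sub_apply, sub_eq_zero]; rfl

lemma finrank_perSub (m0 m d : ℕ) (h : m0 + 2 * m = d) (b : Fin m → ℝ) (T : ℝ) :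
    Module.finrank ℝ (perSub (rotBlockMat m0 m d h b) T) =
      m0 + 2 * Nat.card {j // Complex.exp (T * (b j * Complex.I)) = 1} := by
  classical
  let J := {j // Complex.exp (T * (b j * Complex.I)) = 1}
  let ext0 : (J → ℂ) →ₗ[ℝ] (Fin m → ℂ) :=
    { toFun := fun z j => if hj : Complex.exp (T * (b j * Complex.I)) = 1 then z ⟨j, hj⟩ else 0
      map_add' := by intro z w; funext j; by_cases hj : Complex.exp (T * (b j * Complex.I)) = 1 <;> simp [hj]
      map_smul' := by intro a w; funext j; by_cases hj : Complex.exp (T * (b j * Complex.I)) = 1 <;> simp [hj] }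
  let F : ((Fin m0 → ℝ) × (J → ℂ)) →ₗ[ℝ] Euc d :=
    (rotCoord m0 m d h).symm.toLinearMap ∘ₗ (LinearMap.prodMap LinearMap.id ext0)
  have hext : Function.Injective ext0 := by
    intro z w hzw
    funext j
    have := congrFun hzw j.1
    simpa [ext0, j.2] using this
  have hF : Function.Injective F := by
    intro z w hzw
    have h1 := (rotCoord m0 m d h).symm.injective hzw
    have h2 := Prod.ext_iff.1 h1
    exact Prod.ext h2.1 (hext h2.2)
  have hr : LinearMap.range F = perSub (rotBlockMat m0 m d h b) T := by
    ext x
    rw [mem_perSub, ← (rotCoord m0 m d h).injective.eq_iff, rotCoord_flow]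
    constructor
    · rintro ⟨⟨u, z⟩, rfl⟩
      have : rotCoord m0 m d h (F (u, z)) = (u, ext0 z) := by simp [F]
      rw [this]
      refine Prod.ext rfl ?_
      funext j
      by_cases hj : Complex.exp (T * (b j * Complex.I)) = 1
      · simp [hj]
      · simp [ext0, hj]
    · intro hx
      have hx2 := fun j => congrFun (Prod.ext_iff.1 hx).2 j
      refine ⟨((rotCoord m0 m d h x).1, fun j => (rotCoord m0 m d h x).2 j.1), ?_⟩
      apply (rotCoord m0 m d h).injective
      simp only [F, LinearMap.comp_apply, LinearEquiv.coe_coe, LinearEquiv.apply_symm_apply]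
      refine Prod.ext rfl ?_
      funext j
      by_cases hj : Complex.exp (T * (b j * Complex.I)) = 1
      · simp [ext0, hj]
      · have h3 := hx2 j
        have h4 : (rotCoord m0 m d h x).2 j = 0 := by
          by_contra h0
          exact hj ((mul_eq_right₀ h0).1 h3)
        simp [ext0, hj, h4]
  rw [← hr, LinearMap.finrank_range_of_inj hF, Module.finrank_prod, Module.finrank_fin_fun,
    Module.finrank_pi_fintype]
  simp [Complex.finrank_real_complex, J, mul_comm]

/-- periods as a subgroup -/
def perGroup (A : Matrix (Fin d) (Fin d) ℝ) (x : Euc d) : AddSubgroup ℝ where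
  carrier := {t | linFlow A t x = x}
  zero_mem' := flow_zero A x
  add_mem' := by
    intro s t hs ht
    change linFlow A s x = x at hs
    change linFlow A t x = x at ht
    change linFlow A (s + t) x = x
    rw [flow_add, ht, hs]
  neg_mem' := by
    intro t ht
    change linFlow A t x = x at ht
    change linFlow A (-t) x = x
    conv_lhs => rw [← ht]
    rw [← flow_add, neg_add_cancel, flow_zero]

lemma perGroup_closed (A : Matrix (Fin d) (Fin d) ℝ) (x : Euc d) :
    IsClosed (perGroup A x : Set ℝ) :=
  isClosed_eq (flow_continuous A x) continuous_const

lemma flow_fix_iff (A B : Matrix (Fin d) (Fin d) ℝ) (x y : Euc d)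
    (h : minPeriod A x = minPeriod B y) (t : ℝ) : linFlow A t x = x ↔ linFlow B t y = y := by
  constructor
  · intro ht
    exact closed_subgroup_le (perGroup A x) (perGroup B y) (perGroup_closed A x) (perGroup_closed B y) h ht
  · intro ht
    exact closed_subgroup_le (perGroup B y) (perGroup A x) (perGroup_closed B y) (perGroup_closed A x) h.symm ht

lemma exp_iff (T β : ℝ) (hβ : 0 < β) (hT : T = 2 * Real.pi / β) (a : ℝ) :
    Complex.exp (T * (a * Complex.I)) = 1 ↔ ∃ k : ℤ, a = k * β := by
  have hpi := Real.pi_pos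
  rw [Complex.exp_eq_one_iff]
  apply exists_congr
  intro k
  have e1 : (T : ℂ) * (a * Complex.I) = ((T * a : ℝ) : ℂ) * Complex.I := by push_cast; ring
  have e2 : (k : ℂ) * (2 * Real.pi * Complex.I) = ((k * (2 * Real.pi) : ℝ) : ℂ) * Complex.I := by push_cast; ring
  rw [e1, e2, mul_left_inj' Complex.I_ne_zero, Complex.ofReal_inj, hT]
  field_simp

lemma main_i_ii {d m0 n0 m n : ℕ}
    (hmd : m0 + 2 * m = d) (hnd : n0 + 2 * n = d)
    (b : Fin m → ℝ) (hb : ∀ j, 0 < b j) (c : Fin n → ℝ) (hc : ∀ j, 0 < c j)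
    (U : Set (Euc d)) (hU : IsOpen U) (h0 : (0 : Euc d) ∈ U)
    (f : Euc d → Euc d) (hf : ContinuousOn f U) (hinj : Set.InjOn f U)
    (hper : ∀ x ∈ U, minPeriod (rotBlockMat m0 m d hmd b) x
            = minPeriod (rotBlockMat n0 n d hnd c) (f x)) :
    m0 = n0 ∧ m = n ∧ ∃ p : Fin m ≃ Fin n, ∀ j, b j = c (p j) := by
  have hdim : ∀ T : ℝ, m0 + 2 * Nat.card {j // Complex.exp (T * (b j * Complex.I)) = 1} =
      n0 + 2 * Nat.card {j // Complex.exp (T * (c j * Complex.I)) = 1} := by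
    intro T
    rw [← finrank_perSub m0 m d hmd b T, ← finrank_perSub n0 n d hnd c T]
    refine dim_eq_of_inj _ _ U hU 0 h0 (Submodule.zero_mem _) f hf hinj ?_
    intro x hx
    rw [mem_perSub, mem_perSub]
    exact flow_fix_iff _ _ _ _ (hper x hx) T
  have hcard : ∀ β : ℝ, 0 < β → m0 + 2 * Nat.card {j // ∃ k : ℤ, b j = k * β} =
      n0 + 2 * Nat.card {j // ∃ k : ℤ, c j = k * β} := by
    intro β hβ
    have := hdim (2 * Real.pi / β)
    simpa only [exp_iff _ β hβ rfl] using this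
  have hbig : ∃ β : ℝ, 0 < β ∧ (∀ j, b j < β) ∧ ∀ j, c j < β := by
    refine ⟨1 + ∑ j, b j + ∑ j, c j, ?_, ?_, ?_⟩
    · have := Finset.sum_nonneg (s := Finset.univ) (fun j _ => (hb j).le)
      have := Finset.sum_nonneg (s := Finset.univ) (fun j _ => (hc j).le)
      linarith
    · intro j
      have := Finset.single_le_sum (s := Finset.univ) (f := b) (fun j _ => (hb j).le) (Finset.mem_univ j)
      have := Finset.sum_nonneg (s := Finset.univ) (fun j _ => (hc j).le)
      linarith
    · intro j
      have := Finset.single_le_sum (s := Finset.univ) (f := c) (fun j _ => (hc j).le) (Finset.mem_univ j)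
      have := Finset.sum_nonneg (s := Finset.univ) (fun j _ => (hb j).le)
      linarith
  obtain ⟨β, hβ, hbβ, hcβ⟩ := hbig
  have hno : ∀ a : ℝ, 0 < a → a < β → ¬ ∃ k : ℤ, a = k * β := by
    rintro a ha haβ ⟨k, rfl⟩
    have hk : 0 < k := by exact_mod_cast pos_of_mul_pos_left ha hβ.le
    have hk1 : (1:ℝ) ≤ k := by exact_mod_cast hk
    nlinarith
  have hz := hcard β hβ
  have e1 : IsEmpty {j // ∃ k : ℤ, b j = k * β} := ⟨fun j => hno _ (hb j.1) (hbβ j.1) j.2⟩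
  have e2 : IsEmpty {j // ∃ k : ℤ, c j = k * β} := ⟨fun j => hno _ (hc j.1) (hcβ j.1) j.2⟩
  rw [Nat.card_of_isEmpty, Nat.card_of_isEmpty] at hz
  have hm0 : m0 = n0 := by omega
  have hmn : m = n := by omega
  subst hm0 hmn
  refine ⟨rfl, rfl, count_perm b c hb hc ?_⟩
  intro γ hγ
  have := hcard γ hγ
  omega

lemma main_ii_iii {d m0 m : ℕ} (hmd : m0 + 2 * m = d)
    (b : Fin m → ℝ) (c : Fin m → ℝ) (p : Fin m ≃ Fin m) (hp : ∀ j, b j = c (p j)) :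
    ∃ h : Euc d ≃ₗ[ℝ] Euc d, ∀ (t : ℝ) (x : Euc d),
        h (linFlow (rotBlockMat m0 m d hmd b) t x)
          = linFlow (rotBlockMat m0 m d hmd c) t (h x) := by
  let L := rotCoord m0 m d hmd
  let Q : ((Fin m0 → ℝ) × (Fin m → ℂ)) ≃ₗ[ℝ] ((Fin m0 → ℝ) × (Fin m → ℂ)) :=
    LinearEquiv.prodCongr (LinearEquiv.refl ℝ _) (LinearEquiv.funCongrLeft ℝ ℂ p.symm)
  refine ⟨L.trans (Q.trans L.symm), fun t x => ?_⟩
  apply L.injective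
  have e : ∀ y, L ((L.trans (Q.trans L.symm)) y) = Q (L y) := fun y => by simp
  rw [e]
  simp only [L, rotCoord_flow]
  change _ = ((L ((L.trans (Q.trans L.symm)) x)).1, fun j => Complex.exp (t * (c j * Complex.I)) * (L ((L.trans (Q.trans L.symm)) x)).2 j)
  rw [e]
  refine Prod.ext rfl ?_
  funext j
  change Complex.exp (t * (b (p.symm j) * Complex.I)) * (L x).2 (p.symm j) = Complex.exp (t * (c j * Complex.I)) * (L x).2 (p.symm j)
  rw [hp, Equiv.apply_symm_apply]

lemma main_iii_i (A B : Matrix (Fin d) (Fin d) ℝ) (h : Euc d ≃ₗ[ℝ] Euc d)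
    (hh : ∀ (t : ℝ) (x : Euc d), h (linFlow A t x) = linFlow B t (h x)) :
    ∃ U : Set (Euc d), IsOpen U ∧ (0 : Euc d) ∈ U ∧
        ∃ f : Euc d → Euc d, ContinuousOn f U ∧ Set.InjOn f U ∧
          ∀ x ∈ U, minPeriod A x = minPeriod B (f x) := by
  refine ⟨Set.univ, isOpen_univ, Set.mem_univ _, h, ?_, h.injective.injOn, ?_⟩
  · exact (h.toLinearMap.continuous_of_finiteDimensional).continuousOn
  · intro x _
    have : ∀ t, linFlow A t x = x ↔ linFlow B t (h x) = h x := fun t => by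
      rw [← hh, h.injective.eq_iff]
    simp only [minPeriod, this]

/-- **Lemma 5.1 (minimal periods)**: for the flows generated by
`diag [O_{m0}, J_1(i b_1), …, J_1(i b_m)]` and `diag [O_{n0}, J_1(i c_1), …, J_1(i c_n)]`
on `ℝ^d` (`m0 + 2m = n0 + 2n = d`, all `b_j, c_j > 0`), the following are equivalent:
(i) some continuous injection `f` on an open neighbourhood `U` of `0` preserves minimal
periods; (ii) `(m0, m) = (n0, n)` and `b_j = c_{p(j)}` for some permutation `p`;
(iii) the two flows are linearly conjugate. -/
theorem rotation_minimal_periods {d m0 n0 m n : ℕ} (hm : 0 < m) (hn : 0 < n)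
    (hmd : m0 + 2 * m = d) (hnd : n0 + 2 * n = d)
    (b : Fin m → ℝ) (hb : ∀ j, 0 < b j) (c : Fin n → ℝ) (hc : ∀ j, 0 < c j) :
    ((∃ U : Set (Euc d), IsOpen U ∧ (0 : Euc d) ∈ U ∧
        ∃ f : Euc d → Euc d, ContinuousOn f U ∧ Set.InjOn f U ∧
          ∀ x ∈ U, minPeriod (rotBlockMat m0 m d hmd b) x
            = minPeriod (rotBlockMat n0 n d hnd c) (f x)) ↔
      (m0 = n0 ∧ m = n ∧ ∃ p : Fin m ≃ Fin n, ∀ j, b j = c (p j))) ∧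
    ((m0 = n0 ∧ m = n ∧ ∃ p : Fin m ≃ Fin n, ∀ j, b j = c (p j)) ↔
      (∃ h : Euc d ≃ₗ[ℝ] Euc d, ∀ (t : ℝ) (x : Euc d),
        h (linFlow (rotBlockMat m0 m d hmd b) t x)
          = linFlow (rotBlockMat n0 n d hnd c) t (h x))) := by
  have h12 : (∃ U : Set (Euc d), IsOpen U ∧ (0 : Euc d) ∈ U ∧
        ∃ f : Euc d → Euc d, ContinuousOn f U ∧ Set.InjOn f U ∧
          ∀ x ∈ U, minPeriod (rotBlockMat m0 m d hmd b) x
            = minPeriod (rotBlockMat n0 n d hnd c) (f x)) →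
      (m0 = n0 ∧ m = n ∧ ∃ p : Fin m ≃ Fin n, ∀ j, b j = c (p j)) := by
    rintro ⟨U, hU, h0, f, hf, hinj, hper⟩
    exact main_i_ii hmd hnd b hb c hc U hU h0 f hf hinj hper
  have h23 : (m0 = n0 ∧ m = n ∧ ∃ p : Fin m ≃ Fin n, ∀ j, b j = c (p j)) →
      (∃ h : Euc d ≃ₗ[ℝ] Euc d, ∀ (t : ℝ) (x : Euc d),
        h (linFlow (rotBlockMat m0 m d hmd b) t x)
          = linFlow (rotBlockMat n0 n d hnd c) t (h x)) := by
    rintro ⟨rfl, rfl, p, hp⟩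
    exact main_ii_iii hmd b c p hp
  have h31 : (∃ h : Euc d ≃ₗ[ℝ] Euc d, ∀ (t : ℝ) (x : Euc d),
        h (linFlow (rotBlockMat m0 m d hmd b) t x)
          = linFlow (rotBlockMat n0 n d hnd c) t (h x)) →
      (∃ U : Set (Euc d), IsOpen U ∧ (0 : Euc d) ∈ U ∧
        ∃ f : Euc d → Euc d, ContinuousOn f U ∧ Set.InjOn f U ∧
          ∀ x ∈ U, minPeriod (rotBlockMat m0 m d hmd b) x
            = minPeriod (rotBlockMat n0 n d hnd c) (f x)) := by
    rintro ⟨h, hh⟩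
    exact main_iii_i _ _ h hh
  exact ⟨⟨h12, fun h => h31 (h23 h)⟩, ⟨h23, fun h => h12 (h31 h)⟩⟩

end LF
end
end
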